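/- arXiv:2601.09681 — 7 statements merged into one kernel-verified Lean document; each statement's English description precedes it below -/
import Mathlib

section
/- Let K be a set of colors such that no color in K is S-related to a color outside K (i.e., K is a union of connected components of the swap graph). Then for every configuration g reachable from f, the set of vertices holding a color in K is the same in g as in f: {v : g v ∈ K} = {v : f v ∈ K}. -/
/-- A single allowed swap: the colors at two adjacent vertices `u, v` are exchanged,
provided the two colors are related by the swap relation `S`. -/
def SwapStep {V : Type*} [DecidableEq V] (G : SimpleGraph V) (S : ℕ → ℕ → Prop)
    (f g : V → ℕ) : Prop :=
  ∃ u v : V, G.Adj u v ∧ S (f u) (f v) ∧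
    g = Function.update (Function.update f u (f v)) v (f u)

/-- `g` is reachable from `f` by a finite sequence of allowed swaps. -/
def ReachableConf {V : Type*} [DecidableEq V] (G : SimpleGraph V) (S : ℕ → ℕ → Prop)
    (f g : V → ℕ) : Prop :=
  Relation.ReflTransGen (SwapStep G S) f g

/-- A single swap preserves the set of vertices holding a color in a set `K` that is closed
under the swap relation. -/
theorem SwapStep.setOf_mem_eq {V : Type*} [DecidableEq V] {G : SimpleGraph V}
    {S : ℕ → ℕ → Prop} {K : Set ℕ} (hK : ∀ c d, S c d → (c ∈ K ↔ d ∈ K))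
    {f g : V → ℕ} (h : SwapStep G S f g) : {v | g v ∈ K} = {v | f v ∈ K} := by
  obtain ⟨u, v, -, hs, rfl⟩ := h
  have huv := hK _ _ hs
  ext w
  simp only [Set.mem_ofPred_eq, Function.update_apply]
  split_ifs with hv hu
  · rw [hv, huv]
  · rw [hu, huv]
  · rfl

/-- If `K` is a set of colors such that no color in `K` is `S`-related to a color
outside `K`, then every configuration `g` reachable from `f` has the same set of
vertices holding a color in `K` as `f` does. -/
theorem vertices_with_color_in_component_invariant {V : Type*} [DecidableEq V]
    (G : SimpleGraph V) (S : ℕ → ℕ → Prop) (hS : Symmetric S) (hS' : Irreflexive S)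
    (K : Set ℕ) (hK : ∀ c ∈ K, ∀ d ∉ K, ¬ S c d)
    (f g : V → ℕ) (h : ReachableConf G S f g) :
    {v | g v ∈ K} = {v | f v ∈ K} := by
  have hK' : ∀ c d, S c d → (c ∈ K ↔ d ∈ K) := fun c d hcd =>
    ⟨fun hc => by_contra fun hd => hK c hc d hd hcd,
      fun hd => by_contra fun hc => hK d hd c hc (hS hcd)⟩
  induction h with
  | refl => rfl
  | tail _ hstep ih => exact (hstep.setOf_mem_eq hK').trans ih
end

section
/- Suppose the base graph G is connected and the swap graph is the star centered at color 1. Then for every configuration f and every set B' ⊆ V with |B'| = |B(f)|, there exists a configuration g reachable from f whose blank set is exactly B', i.e., B(g) = B'. -/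
/-- The star swap graph centered at color `1`: two colors may be swapped iff they are
distinct and one of them is `1`. -/
def StarSwap (c d : ℕ) : Prop := c ≠ d ∧ (c = 1 ∨ d = 1)

/-- Along an edge, a blank can be moved onto a non-blank neighbor. -/
theorem exists_swapStep_move_blank {V : Type*} [DecidableEq V] {G : SimpleGraph V}
    {f : V → ℕ} {a c : V} (hac : G.Adj a c) (ha : f a = 1) (hc : f c ≠ 1) :
    ∃ g : V → ℕ, SwapStep G StarSwap f g ∧ ∀ v, g v = 1 ↔ v = c ∨ (v ≠ a ∧ f v = 1) := by
  refine ⟨_, ⟨a, c, hac, ⟨by rw [ha]; exact hc.symm, Or.inl ha⟩, rfl⟩, fun v => ?_⟩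
  have := hac.ne
  simp only [Function.update_apply]
  grind

/-- Along a walk, the blank set can be changed by replacing the blank starting vertex with the
non-blank final vertex. -/
theorem exists_reachableConf_move_blank {V : Type*} [DecidableEq V] {G : SimpleGraph V}
    {a b : V} (p : G.Walk a b) (f : V → ℕ) (ha : f a = 1) (hb : f b ≠ 1) :
    ∃ g : V → ℕ, ReachableConf G StarSwap f g ∧
      ∀ v, g v = 1 ↔ v = b ∨ (v ≠ a ∧ f v = 1) := by
  induction p generalizing f with
  | nil => exact absurd ha hb
  | @cons a c b hac p ih =>
    have hne := hac.ne
    by_cases hc : f c = 1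
    · obtain ⟨g, hfg, hg⟩ := ih f hc hb
      obtain ⟨k, hgk, hk⟩ := exists_swapStep_move_blank (f := g) hac (by grind) (by grind)
      exact ⟨k, hfg.tail hgk, by grind⟩
    · obtain ⟨g, hfg, hg⟩ := exists_swapStep_move_blank hac ha hc
      by_cases hcb : c = b
      · exact ⟨g, .single hfg, by grind⟩
      · obtain ⟨k, hgk, hk⟩ := ih g (by grind) (by grind)
        exact ⟨k, .head hfg hgk, by grind⟩

/-- If the base graph is connected and the swap graph is the star centered at color `1`,
then for every configuration `f` and every set `B'` of vertices of the same cardinality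
as the blank set of `f`, some configuration reachable from `f` has blank set exactly
`B'`. -/
theorem blanks_can_be_moved_anywhere {V : Type*} [DecidableEq V] [Fintype V]
    (G : SimpleGraph V) (hG : G.Connected) (f : V → ℕ) (B' : Set V)
    (hcard : B'.ncard = {v | f v = 1}.ncard) :
    ∃ g : V → ℕ, ReachableConf G StarSwap f g ∧ {v | g v = 1} = B' := by
  induction hn : (B' \ {v | f v = 1}).ncard generalizing f with
  | zero =>
    have hsub : B' ⊆ {v | f v = 1} := by
      rwa [Set.ncard_eq_zero, Set.sdiff_eq_empty] at hn
    exact ⟨f, .refl, (Set.eq_of_subset_of_ncard_le hsub hcard.ge).symm⟩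
  | succ n ih =>
    have hdiff : ({v | f v = 1} \ B').ncard = n + 1 := by
      rw [← hn]
      exact ((Set.ncard_eq_ncard_iff_ncard_sdiff_eq_ncard_sdiff).1 hcard).symm
    obtain ⟨b, hbB, hb⟩ :=
      Set.nonempty_of_ncard_ne_zero (by omega : (B' \ {v | f v = 1}).ncard ≠ 0)
    obtain ⟨a, ha, haB⟩ :=
      Set.nonempty_of_ncard_ne_zero (by omega : ({v | f v = 1} \ B').ncard ≠ 0)
    obtain ⟨p⟩ := hG.preconnected a b
    obtain ⟨g, hfg, hg⟩ := exists_reachableConf_move_blank p f ha hb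
    have hset : {v | g v = 1} = insert b ({v | f v = 1} \ {a}) := by
      ext v
      simp [hg, and_comm]
    have hcard' : B'.ncard = {v | g v = 1}.ncard := by
      rw [hset, Set.ncard_exchange hb ha, hcard]
    have hn' : (B' \ {v | g v = 1}).ncard = n := by
      have : B' \ {v | g v = 1} = (B' \ {v | f v = 1}) \ {b} := by
        ext v
        simp only [Set.mem_sdiff, Set.mem_ofPred_eq, Set.mem_singleton_iff, hg]
        grind
      rw [this, Set.ncard_sdiff_singleton_of_mem (Set.mem_sdiff_of_mem hbB hb), hn, Nat.add_sub_cancel]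
    obtain ⟨k, hgk, hk⟩ := ih g hcard' hn'
    exact ⟨k, hfg.trans hgk, hk⟩
end

section
/- For any configuration f on a finite connected base graph G with the star swap graph centered at color 1, the relation ~ defined on the non-blank vertices V \ B(f) is an equivalence relation: it is reflexive, symmetric, and transitive. -/
/-- `u ~ v`: tracking the token initially at `u` by recoloring it with any fresh color
`c` (`c ≠ 1` and `c` not in the range of `f`), there is a configuration reachable from
the modified configuration that has this token on `v` and the same blank set as `f`. -/
def Sim {V : Type*} [DecidableEq V] (G : SimpleGraph V) (f : V → ℕ) (u v : V) : Prop :=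
  ∀ c : ℕ, c ≠ 1 → c ∉ Set.range f →
    ∃ h : V → ℕ, ReachableConf G StarSwap (Function.update f u c) h ∧ h v = c ∧
      {w | h w = 1} = {w | f w = 1}

/-- Exchanging the values at two points is precomposition with their transposition. -/
theorem update_update_eq_comp_swap {V : Type*} [DecidableEq V] (f : V → ℕ) (u v : V) :
    Function.update (Function.update f u (f v)) v (f u) = f ∘ Equiv.swap u v := by
  funext w
  by_cases hv : w = v
  · subst hv; simp
  · by_cases hu : w = u
    · subst hu; simp [hv]
    · simp [hv, hu, Equiv.swap_apply_of_ne_of_ne]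

/-- Whether two colors may be swapped depends only on which of them are blank. -/
theorem StarSwap.congr {a b a' b' : ℕ} (ha : a' = 1 ↔ a = 1) (hb : b' = 1 ↔ b = 1)
    (h : StarSwap a b) : StarSwap a' b' := by
  unfold StarSwap at *
  grind

theorem SwapStep.symm {V : Type*} [DecidableEq V] {G : SimpleGraph V} {f g : V → ℕ}
    (h : SwapStep G StarSwap f g) : SwapStep G StarSwap g f := by
  obtain ⟨u, v, huv, hs, rfl⟩ := h
  rw [update_update_eq_comp_swap]
  refine ⟨u, v, huv, ?_, ?_⟩
  · simpa using ⟨hs.1.symm, hs.2.symm⟩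
  · rw [update_update_eq_comp_swap]
    funext w
    simp

theorem ReachableConf.symm {V : Type*} [DecidableEq V] {G : SimpleGraph V} {f g : V → ℕ}
    (h : ReachableConf G StarSwap f g) : ReachableConf G StarSwap g f :=
  have : Std.Symm (SwapStep G StarSwap) := ⟨fun _ _ => SwapStep.symm⟩
  Std.Symm.symm (r := Relation.ReflTransGen (SwapStep G StarSwap)) _ _ h

/-- A swap sequence acts by a permutation, which is realized from every configuration with
the same blank vertices. -/
theorem ReachableConf.exists_perm {V : Type*} [DecidableEq V] {G : SimpleGraph V} {f g : V → ℕ}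
    (h : ReachableConf G StarSwap f g) :
    ∃ σ : Equiv.Perm V, g = f ∘ σ ∧
      ∀ f' : V → ℕ, (∀ w, f' w = 1 ↔ f w = 1) → ReachableConf G StarSwap f' (f' ∘ σ) := by
  unfold ReachableConf at h
  induction h with
  | refl => exact ⟨1, rfl, fun f' _ => Relation.ReflTransGen.refl⟩
  | tail _ hstep ih =>
    obtain ⟨σ, rfl, hσ⟩ := ih
    obtain ⟨u, v, huv, hs, rfl⟩ := hstep
    refine ⟨σ * Equiv.swap u v, by rw [update_update_eq_comp_swap]; rfl, fun f' hf' => ?_⟩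
    refine Relation.ReflTransGen.tail (hσ f' hf')
      ⟨u, v, huv, hs.congr (hf' (σ u)) (hf' (σ v)), ?_⟩
    rw [update_update_eq_comp_swap]
    rfl

/-- The permutations that preserve the blank set of `f` and are realized by a swap sequence
from every configuration with the same blank vertices as `f`. -/
def blankPreservingPerms {V : Type*} [DecidableEq V] (G : SimpleGraph V) (f : V → ℕ) :
    Subgroup (Equiv.Perm V) where
  carrier := {σ | (∀ w, f (σ w) = 1 ↔ f w = 1) ∧
    ∀ f' : V → ℕ, (∀ w, f' w = 1 ↔ f w = 1) → ReachableConf G StarSwap f' (f' ∘ σ)}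
  one_mem' := ⟨fun _ => Iff.rfl, fun _ _ => Relation.ReflTransGen.refl⟩
  mul_mem' := by
    rintro σ τ ⟨hσ, hσr⟩ ⟨hτ, hτr⟩
    exact ⟨fun w => (hσ (τ w)).trans (hτ w), fun f' hf' =>
      (hσr f' hf').trans (hτr (f' ∘ σ) fun w => (hf' (σ w)).trans (hσ w))⟩
  inv_mem' := by
    rintro σ ⟨hσ, hσr⟩
    have hinv : ∀ w, f (σ⁻¹ w) = 1 ↔ f w = 1 := fun w => by
      simpa using (hσ (σ⁻¹ w)).symm
    refine ⟨hinv, fun f' hf' => ReachableConf.symm ?_⟩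
    have h := hσr (f' ∘ ⇑σ⁻¹) fun w => (hf' _).trans (hinv w)
    have hcomp : (f' ∘ ⇑σ⁻¹) ∘ σ = f' := by
      funext w
      simp
    rwa [hcomp] at h

theorem sim_iff_exists_perm {V : Type*} [DecidableEq V] [Finite V] {G : SimpleGraph V}
    {f : V → ℕ} {u v : V} (hu : f u ≠ 1) :
    Sim G f u v ↔ ∃ σ ∈ blankPreservingPerms G f, σ v = u := by
  have hblank : ∀ c : ℕ, c ≠ 1 → ∀ w, Function.update f u c w = 1 ↔ f w = 1 := by
    intro c hc w
    by_cases hw : w = u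
    · subst hw; simp [hc, hu]
    · simp [hw]
  constructor
  · intro h
    obtain ⟨c, hc⟩ := ((Set.finite_range f).insert 1).exists_notMem
    rw [Set.mem_insert_iff, not_or] at hc
    obtain ⟨g, hg, hgv, hgB⟩ := h c hc.1 hc.2
    obtain ⟨σ, rfl, hσ⟩ := hg.exists_perm
    refine ⟨σ, ⟨fun w => ?_, fun f' hf' => hσ f' fun w => (hf' w).trans (hblank c hc.1 w).symm⟩,
      ?_⟩
    · exact (hblank c hc.1 (σ w)).symm.trans (Set.ext_iff.mp hgB w)
    · by_contra hne
      rw [Function.comp_apply, Function.update_of_ne hne] at hgv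
      exact hc.2 ⟨σ v, hgv⟩
  · rintro ⟨σ, ⟨hσ, hσr⟩, hσv⟩ c hc _
    refine ⟨Function.update f u c ∘ σ, hσr _ (hblank c hc), by simp [hσv], ?_⟩
    ext w
    exact (hblank c hc (σ w)).trans (hσ w)

/-- On a finite connected base graph with the star swap graph centered at color `1`,
the relation `~` is an equivalence relation on the non-blank vertices: it is reflexive,
symmetric, and transitive. -/
theorem sim_is_equivalence {V : Type*} [DecidableEq V] [Fintype V]
    (G : SimpleGraph V) (hG : G.Connected) (f : V → ℕ) :
    (∀ u : V, f u ≠ 1 → Sim G f u u) ∧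
    (∀ u v : V, f u ≠ 1 → f v ≠ 1 → Sim G f u v → Sim G f v u) ∧
    (∀ u v w : V, f u ≠ 1 → f v ≠ 1 → f w ≠ 1 →
      Sim G f u v → Sim G f v w → Sim G f u w) := by
  refine ⟨fun u hu => ?_, fun u v hu hv h => ?_, fun u v w hu hv hw h₁ h₂ => ?_⟩
  · exact (sim_iff_exists_perm hu).2 ⟨1, one_mem _, rfl⟩
  · obtain ⟨σ, hσ, rfl⟩ := (sim_iff_exists_perm hu).1 h
    exact (sim_iff_exists_perm hv).2 ⟨σ⁻¹, inv_mem hσ, by simp⟩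
  · obtain ⟨σ, hσ, rfl⟩ := (sim_iff_exists_perm hu).1 h₁
    obtain ⟨τ, hτ, rfl⟩ := (sim_iff_exists_perm hv).1 h₂
    exact (sim_iff_exists_perm hu).2 ⟨σ * τ, mul_mem hσ hτ, rfl⟩
end

section
/- Let (G, f, g) be an instance of colored token swapping with the star swap graph centered at color 1, with B(f) = B(g), and let C be an equivalence class of ~. Then the sub-instance I_C is transitive: in I_C, the set of non-blank vertices (which is exactly C) forms a single equivalence class of the relation ~ computed within I_C. -/
/-- `R(u)`: the set of vertices reachable by the token initially at `u` (tracked via a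
fresh color `c`), without any requirement on the final blank set. -/
def RSet {V : Type*} [DecidableEq V] (G : SimpleGraph V) (f : V → ℕ) (u : V) : Set V :=
  {v | ∀ c : ℕ, c ≠ 1 → c ∉ Set.range f →
    ∃ h : V → ℕ, ReachableConf G StarSwap (Function.update f u c) h ∧ h v = c}

/-- `R(C) = ⋃_{u ∈ C} R(u)`. -/
def RC {V : Type*} [DecidableEq V] (G : SimpleGraph V) (f : V → ℕ) (C : Set V) : Set V :=
  ⋃ u ∈ C, RSet G f u

/-- `C` is an equivalence class of `~` (on the non-blank vertices of `f`). -/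
def IsClass {V : Type*} [DecidableEq V] (G : SimpleGraph V) (f : V → ℕ) (C : Set V) :
    Prop :=
  ∃ u : V, f u ≠ 1 ∧ C = {v | f v ≠ 1 ∧ Sim G f u v}

open scoped Classical in
/-- The configuration of the sub-instance `I_C` on the vertex set `W = C ∪ R(C)`:
it agrees with `f` on `C` and is constantly `1` (blank) elsewhere. -/
noncomputable def subConfig {V : Type*} (f : V → ℕ) (C W : Set V) : ↥W → ℕ :=
  fun x => if (x : V) ∈ C then f x else 1

/-- `TokenReach G P σ`: starting with every token on its own vertex, where `P u` says that the
token of `u` is not blank, finitely many swaps of a non-blank and a blank token along edges of `G`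
lead to the placement in which the vertex `w` carries the token of `σ w`. -/
inductive TokenReach {V : Type*} [DecidableEq V] (G : SimpleGraph V) (P : V → Prop) :
    Equiv.Perm V → Prop
  | refl : TokenReach G P 1
  | step {σ : Equiv.Perm V} {u v : V} : TokenReach G P σ → G.Adj u v → P (σ u) → ¬ P (σ v) →
      TokenReach G P (σ * Equiv.swap u v)

theorem exists_fresh_color {V : Type*} [Finite V] (f : V → ℕ) : ∃ c, c ≠ 1 ∧ c ∉ Set.range f := by
  obtain ⟨c, hc⟩ := ((Set.finite_range f).insert 1).exists_notMem
  exact ⟨c, fun h => hc (Or.inl h), fun h => hc (Or.inr h)⟩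

theorem subConfig_ne_one_iff {V : Type*} {f : V → ℕ} {C W : Set V} (hC : ∀ w ∈ C, f w ≠ 1) (x : W) :
    subConfig f C W x ≠ 1 ↔ (x : V) ∈ C := by
  by_cases hx : (x : V) ∈ C
  · simp [subConfig, hx, hC x hx]
  · simp [subConfig, hx]

section TokenReach

variable {V : Type*} [DecidableEq V] {G : SimpleGraph V}

theorem comp_mul_swap (f : V → ℕ) (σ : Equiv.Perm V) (u v : V) :
    f ∘ ⇑(σ * Equiv.swap u v) =
      Function.update (Function.update (f ∘ σ) u ((f ∘ σ) v)) v ((f ∘ σ) u) := by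
  funext w
  by_cases hv : w = v
  · subst hv
    simp
  · by_cases hu : w = u
    · subst hu
      simp [hv]
    · simp [hu, hv, Equiv.swap_apply_of_ne_of_ne]

theorem TokenReach.reachableConf {P : V → Prop} {f : V → ℕ} (hP : ∀ w, P w ↔ f w ≠ 1)
    {σ : Equiv.Perm V} (h : TokenReach G P σ) : ReachableConf G StarSwap f (f ∘ σ) := by
  induction h with
  | refl => exact Relation.ReflTransGen.refl
  | @step σ u v _ hadj hu hv ih =>
    have hu' : f (σ u) ≠ 1 := (hP _).1 hu
    have hv' : f (σ v) = 1 := by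
      by_contra h
      exact hv ((hP _).2 h)
    refine Relation.ReflTransGen.tail ih ⟨u, v, hadj, ⟨?_, Or.inr hv'⟩, comp_mul_swap f σ u v⟩
    simpa [hv'] using hu'

theorem ReachableConf.exists_tokenReach {P : V → Prop} {f h : V → ℕ} (hP : ∀ w, P w ↔ f w ≠ 1)
    (hr : ReachableConf G StarSwap f h) : ∃ σ, TokenReach G P σ ∧ h = f ∘ σ := by
  induction hr with
  | refl => exact ⟨1, .refl, rfl⟩
  | tail _ hstep ih =>
    obtain ⟨σ, hσ, rfl⟩ := ih
    obtain ⟨u, v, hadj, ⟨hne, h1⟩, rfl⟩ := hstep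
    refine ⟨σ * Equiv.swap u v, ?_, (comp_mul_swap f σ u v).symm⟩
    simp only [Function.comp_apply] at hne h1
    rcases h1 with h1 | h1
    · rw [Equiv.swap_comm]
      refine .step hσ hadj.symm ((hP _).2 fun h => hne (h1.trans h.symm)) ?_
      simp [hP, h1]
    · refine .step hσ hadj ((hP _).2 fun h => hne (h.trans h1.symm)) ?_
      simp [hP, h1]

theorem TokenReach.mul {P : V → Prop} {σ τ : Equiv.Perm V} (hσ : TokenReach G P σ)
    (hP : ∀ w, P (σ w) ↔ P w) (hτ : TokenReach G P τ) : TokenReach G P (σ * τ) := by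
  induction hτ with
  | refl => simpa using hσ
  | step _ hadj hu hv ih =>
    rw [← mul_assoc]
    exact .step ih hadj ((hP _).2 hu) fun h => hv ((hP _).1 h)

variable (G) in
/-- The reachable token placements whose set of blank vertices is the initial one. -/
def closedPlacements (P : V → Prop) : Submonoid (Equiv.Perm V) where
  carrier := {σ | TokenReach G P σ ∧ ∀ w, P (σ w) ↔ P w}
  one_mem' := ⟨.refl, fun _ => Iff.rfl⟩
  mul_mem' := fun hσ hτ => ⟨hσ.1.mul hσ.2 hτ.1, fun w => (hσ.2 _).trans (hτ.2 w)⟩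

theorem inv_mem_closedPlacements [Finite V] {P : V → Prop} {σ : Equiv.Perm V}
    (hσ : σ ∈ closedPlacements G P) : σ⁻¹ ∈ closedPlacements G P := by
  have hpos := orderOf_pos σ
  have h : σ⁻¹ = σ ^ (orderOf σ - 1) := by
    rw [inv_eq_iff_mul_eq_one, ← pow_succ', Nat.sub_add_cancel hpos, pow_orderOf_eq_one]
  rw [h]
  exact pow_mem hσ _

theorem update_ne_one_iff {f : V → ℕ} {u : V} {c : ℕ} (hu : f u ≠ 1) (hc : c ≠ 1) (w : V) :
    Function.update f u c w ≠ 1 ↔ f w ≠ 1 := by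
  by_cases h : w = u
  · subst h
    simp [hu, hc]
  · simp [h]

theorem update_eq_iff_of_notMem_range {f : V → ℕ} {u : V} {c : ℕ} (hc : c ∉ Set.range f) (w : V) :
    Function.update f u c w = c ↔ w = u := by
  by_cases h : w = u
  · simp [h]
  · simpa [h] using fun hw => hc ⟨w, hw⟩

theorem sim_of_mem_closedPlacements {P : V → Prop} {f : V → ℕ} (hP : ∀ w, P w ↔ f w ≠ 1)
    {σ : Equiv.Perm V} (hσ : σ ∈ closedPlacements G P) {u v : V} (hu : f u ≠ 1) (huv : σ v = u) :
    Sim G f u v := by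
  intro c hc hcf
  have hup := update_ne_one_iff hu hc
  refine ⟨Function.update f u c ∘ σ,
    hσ.1.reachableConf fun w => (hP w).trans (hup w).symm, ?_, ?_⟩
  · simp [huv]
  · ext w
    have := (hup (σ w)).trans ((hP _).symm.trans ((hσ.2 w).trans (hP w)))
    exact not_iff_not.1 this

theorem sim_iff_exists_mem_closedPlacements [Finite V] {P : V → Prop} {f : V → ℕ}
    (hP : ∀ w, P w ↔ f w ≠ 1) {u v : V} (hu : f u ≠ 1) :
    Sim G f u v ↔ ∃ σ ∈ closedPlacements G P, σ v = u := by
  refine ⟨fun h => ?_, fun ⟨σ, hσ, huv⟩ => sim_of_mem_closedPlacements hP hσ hu huv⟩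
  obtain ⟨c, hc, hcf⟩ := exists_fresh_color f
  have hup := update_ne_one_iff hu hc
  obtain ⟨h, hr, hv, hB⟩ := h c hc hcf
  obtain ⟨σ, hσ, rfl⟩ := hr.exists_tokenReach fun w => (hP w).trans (hup w).symm
  refine ⟨σ, ⟨hσ, fun w => ?_⟩, (update_eq_iff_of_notMem_range hcf _).1 hv⟩
  rw [hP, hP, ← hup]
  exact not_iff_not.2 (Set.ext_iff.1 hB w)

theorem TokenReach.mem_RSet {P : V → Prop} {f : V → ℕ} (hP : ∀ w, P w ↔ f w ≠ 1)
    {σ : Equiv.Perm V} (hσ : TokenReach G P σ) {u v : V} (hu : f u ≠ 1) (huv : σ v = u) :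
    v ∈ RSet G f u := by
  intro c hc _
  exact ⟨Function.update f u c ∘ σ,
    hσ.reachableConf fun w => (hP w).trans (update_ne_one_iff hu hc w).symm, by simp [huv]⟩

/-- Declaring the tokens outside `C` blank turns a swap sequence in `G` into one in the subgraph
induced by any set of vertices that the tokens of `C` never leave. -/
theorem TokenReach.exists_induce {P : V → Prop} {C W : Set V} (hCP : ∀ w ∈ C, P w)
    (hW : ∀ τ : Equiv.Perm V, TokenReach G P τ → ∀ w, τ w ∈ C → w ∈ W)
    {σ : Equiv.Perm V} (hσ : TokenReach G P σ) :
    ∃ ρ : Equiv.Perm W, TokenReach (G.induce W) (fun w => (w : V) ∈ C) ρ ∧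
      ∀ w : W, ∀ c ∈ C, (ρ w : V) = c ↔ σ w = c := by
  induction hσ with
  | refl => exact ⟨1, .refl, fun _ _ _ => Iff.rfl⟩
  | @step σ u v hσ hadj hu hv ih =>
    obtain ⟨ρ, hρ, hρσ⟩ := ih
    have hvC : σ v ∉ C := fun h => hv (hCP _ h)
    by_cases huC : σ u ∈ C
    · have huW : u ∈ W := hW σ hσ u huC
      have hvW : v ∈ W := hW _ (.step hσ hadj hu hv) v (by simpa using huC)
      refine ⟨ρ * Equiv.swap ⟨u, huW⟩ ⟨v, hvW⟩, .step hρ (SimpleGraph.induce_adj.2 hadj) ?_ ?_, fun w c hc => ?_⟩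
      · rw [(hρσ ⟨u, huW⟩ _ huC).2 rfl]
        exact huC
      · intro h
        exact hvC (by rw [(hρσ ⟨v, hvW⟩ _ h).1 rfl]; exact h)
      · have hswap : ((Equiv.swap (⟨u, huW⟩ : W) ⟨v, hvW⟩ w : W) : V) = Equiv.swap u v w := by
          simp only [Equiv.swap_apply_def, Subtype.ext_iff]
          split_ifs <;> rfl
        rw [Equiv.Perm.mul_apply, Equiv.Perm.mul_apply, hρσ _ c hc, hswap]
    · refine ⟨ρ, hρ, fun w c hc => (hρσ w c hc).trans ?_⟩
      rw [Equiv.Perm.mul_apply]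
      by_cases hwu : (w : V) = u
      · rw [hwu, Equiv.swap_apply_left]
        exact ⟨fun h => (huC (h ▸ hc)).elim, fun h => (hvC (h ▸ hc)).elim⟩
      · by_cases hwv : (w : V) = v
        · rw [hwv, Equiv.swap_apply_right]
          exact ⟨fun h => (hvC (h ▸ hc)).elim, fun h => (huC (h ▸ hc)).elim⟩
        · rw [Equiv.swap_apply_of_ne_of_ne hwu hwv]

/-- An equivalence class of `~` is an orbit of the closed placements. -/
theorem IsClass.exists_mem_iff [Finite V] {f : V → ℕ} {C : Set V} (hC : IsClass G f C) :
    ∃ u, ∀ v, v ∈ C ↔ ∃ σ ∈ closedPlacements G (fun w => f w ≠ 1), σ v = u := by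
  obtain ⟨u, hu, rfl⟩ := hC
  refine ⟨u, fun v => ?_⟩
  rw [Set.mem_ofPred_eq, sim_iff_exists_mem_closedPlacements (fun _ => Iff.rfl) hu]
  refine and_iff_right_of_imp ?_
  rintro ⟨σ, hσ, rfl⟩
  exact (hσ.2 v).1 hu

end TokenReach

/-- For every equivalence class `C` of `~`, the sub-instance `I_C` (on the subgraph of
`G` induced by `C ∪ R(C)`, with initial configuration `f` on `C` and blank elsewhere)
is transitive: its set of non-blank vertices is exactly `C`, and these form a single
equivalence class of the relation `~` computed within `I_C`. -/
theorem subinstance_transitive {V : Type*} [DecidableEq V] [Fintype V]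
    (G : SimpleGraph V) (f g : V → ℕ) (hB : {v | f v = 1} = {v | g v = 1})
    (C : Set V) (hC : IsClass G f C) :
    (∀ x : ↥(C ∪ RC G f C), subConfig f C (C ∪ RC G f C) x ≠ 1 ↔ (x : V) ∈ C) ∧
    (∀ x y : ↥(C ∪ RC G f C),
      subConfig f C (C ∪ RC G f C) x ≠ 1 →
      subConfig f C (C ∪ RC G f C) y ≠ 1 →
      Sim (G.induce (C ∪ RC G f C)) (subConfig f C (C ∪ RC G f C)) x y) := by
  have hCf : ∀ w ∈ C, f w ≠ 1 := by
    obtain ⟨u, _, rfl⟩ := hC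
    exact fun w hw => hw.1
  have hsub := fun x : ↥(C ∪ RC G f C) => subConfig_ne_one_iff hCf x
  refine ⟨hsub, fun x y hx hy => ?_⟩
  obtain ⟨u, hu⟩ := hC.exists_mem_iff
  obtain ⟨σ, hσ, hσx⟩ := (hu x).1 ((hsub x).1 hx)
  obtain ⟨τ, hτ, hτy⟩ := (hu y).1 ((hsub y).1 hy)
  have hπ := mul_mem (inv_mem_closedPlacements hσ) hτ
  set π := σ⁻¹ * τ with hπ_def
  have hπy : π y = x := by
    rw [hπ_def, Equiv.Perm.mul_apply, hτy, ← hσx, Equiv.Perm.inv_eq_iff_eq]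
  have hinv : ∀ w, π w ∈ C ↔ w ∈ C := by
    intro w
    rw [hu, hu]
    constructor
    · rintro ⟨μ, hμ, h⟩
      exact ⟨μ * π, mul_mem hμ hπ, h⟩
    · rintro ⟨μ, hμ, h⟩
      exact ⟨μ * π⁻¹, mul_mem hμ (inv_mem_closedPlacements hπ), by simpa using h⟩
  obtain ⟨ρ, hρ, hρπ⟩ := hπ.1.exists_induce (C := C) (W := C ∪ RC G f C) hCf
    fun μ hμ w hw => Or.inr (Set.mem_biUnion hw
      (hμ.mem_RSet (fun _ => Iff.rfl) (hCf _ hw) rfl))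
  refine sim_of_mem_closedPlacements (fun w => (hsub w).symm) ⟨hρ, fun w => ?_⟩ hx
    (Subtype.ext ((hρπ y x ((hsub x).1 hx)).2 hπy))
  change (ρ w : V) ∈ C ↔ (w : V) ∈ C
  constructor
  · intro h
    rw [← hinv, (hρπ w _ h).1 rfl]
    exact h
  · intro h
    have h' := (hinv w).2 h
    rw [(hρπ w _ h').2 rfl]
    exact h'
end

section
/- Let (G, f, g) be an instance of colored token swapping with the star swap graph centered at color 1, with B(f) = B(g), such that every color other than 1 is held by exactly one vertex in f and by exactly one vertex in g (all tokens of color other than 1 have pairwise distinct colors). Then the instance is solvable if and only if, for every equivalence class C of ~, the sub-instance I_C is solvable. -/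
namespace TokenSwap

open Equiv SimpleGraph

variable {V : Type*}

/-- The spanning subgraph of `G` whose edges are those of `G` inside `S`. -/
def restr (G : SimpleGraph V) (S : Set V) : SimpleGraph V where
  Adj a b := G.Adj a b ∧ a ∈ S ∧ b ∈ S
  symm := ⟨fun _ _ h => ⟨h.1.symm, h.2.2, h.2.1⟩⟩
  loopless := ⟨fun _ h => G.loopless.irrefl _ h.1⟩

lemma restr_le (G : SimpleGraph V) (S : Set V) : restr G S ≤ G := fun _ _ h => h.1

variable [DecidableEq V]

/-- `Legal G A σ`: starting from labels placed by the identity, with the labels in `A` blank,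
a sequence of swaps along edges of `G`, each involving a blank label, puts the label `σ q` on
each vertex `q`. -/
inductive Legal (G : SimpleGraph V) (A : Set V) : Perm V → Prop
  | one : Legal G A 1
  | step {σ : Perm V} {u v : V} :
      Legal G A σ → G.Adj u v → σ u ∈ A → Legal G A (σ * swap u v)

namespace Legal

variable {G G' : SimpleGraph V} {A A' : Set V} {σ τ : Perm V}

lemma mono (h : Legal G A σ) (hG : G ≤ G') (hA : A ⊆ A') : Legal G' A' σ := by
  induction h with
  | one => exact .one
  | step _ hadj hb ih => exact ih.step (hG hadj) (hA hb)

lemma of_adj {u v : V} (h : G.Adj u v) (hu : u ∈ A) : Legal G A (swap u v) := by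
  simpa using (Legal.one (G := G) (A := A)).step h (by simpa using hu)

lemma of_adj' {u v : V} (h : G.Adj u v) (hv : v ∈ A) : Legal G A (swap u v) := by
  rw [swap_comm]
  exact of_adj h.symm hv

lemma step' {u v : V} (h : Legal G A σ) (hadj : G.Adj u v) (hv : σ v ∈ A) :
    Legal G A (σ * swap u v) := by
  rw [swap_comm]
  exact h.step hadj.symm hv

lemma mul (hσ : Legal G A σ) (hτ : Legal G {q | σ q ∈ A} τ) : Legal G A (σ * τ) := by
  induction hτ with
  | one => simpa using hσ
  | step _ hadj hb ih =>
    rw [← mul_assoc]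
    exact ih.step hadj hb

lemma inv (hσ : Legal G A σ) : Legal G {q | σ q ∈ A} σ⁻¹ := by
  induction hσ with
  | one => simpa using Legal.one
  | @step σ u v _ hadj hb ih =>
    rw [mul_inv_rev, swap_inv]
    have h := of_adj' (A := {q | (σ * swap u v) q ∈ A}) hadj (by simpa using hb)
    exact h.mul (by simpa using ih)

lemma conj_swap {i j : V} (hσ : Legal G A σ) (hs : Legal G {q | σ q ∈ A} (swap i j))
    (hi : σ i ∉ A) (hj : σ j ∉ A) : Legal G A (swap (σ i) (σ j)) := by
  have h1 := (hσ.mul hs).mul (τ := σ⁻¹) (by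
    have := hσ.inv
    convert this using 1
    ext q
    simp only [Set.mem_ofPred_eq, Perm.mul_apply]
    rw [swap_apply_def]
    split_ifs with h h' <;> grind)
  have h2 : σ * swap i j * σ⁻¹ = swap (σ i) (σ j) := by
    rw [Equiv.mul_swap_eq_swap_mul, mul_assoc, mul_inv_cancel, mul_one]
  rwa [h2] at h1

lemma conj_swap' {i j : V} (hσ : Legal G A σ) (hi : i ∉ A) (hj : j ∉ A)
    (hs : Legal G {q | σ q ∈ A} (swap (σ⁻¹ i) (σ⁻¹ j))) : Legal G A (swap i j) := by
  simpa using hσ.conj_swap hs (by simpa using hi) (by simpa using hj)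

lemma swap_trans {i j k : V} (hi : i ∉ A) (hj : j ∉ A) (hk : k ∉ A)
    (h1 : Legal G A (swap i j)) (h2 : Legal G A (swap j k)) : Legal G A (swap i k) := by
  have key : ∀ q, swap i j q ∈ A ↔ q ∈ A := fun q => by
    rw [swap_apply_def]; split_ifs <;> grind
  by_cases hjk : j = k
  · exact hjk ▸ h1
  by_cases hik : i = k
  · subst hik; rw [swap_self]; exact .one
  refine conj_swap' h1 hi hk ?_
  rw [swap_inv, swap_apply_left, swap_apply_of_ne_of_ne (Ne.symm hik) (Ne.symm hjk)]
  simpa [key] using h2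

end Legal

lemma update_update_eq_comp_swap {α : Type*} (f : V → α) (u v : V) :
    Function.update (Function.update f u (f v)) v (f u) = f ∘ swap u v := by
  ext q
  simp only [Function.update_apply, Function.comp_apply, swap_apply_def]
  split_ifs <;> simp_all

lemma reachableConf_iff {G : SimpleGraph V} {f h : V → ℕ} :
    ReachableConf G StarSwap f h ↔ ∃ σ, Legal G {q | f q = 1} σ ∧ h = f ∘ σ := by
  constructor
  · intro hr
    induction hr with
    | refl => exact ⟨1, .one, rfl⟩
    | tail _ hs ih =>
      obtain ⟨σ, hσ, rfl⟩ := ih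
      obtain ⟨u, v, hadj, hS, rfl⟩ := hs
      refine ⟨σ * swap u v, ?_, update_update_eq_comp_swap (_ ∘ σ) u v⟩
      rcases hS.2 with h1 | h1
      · exact hσ.step hadj h1
      · exact hσ.step' hadj h1
  · rintro ⟨σ, hσ, rfl⟩
    induction hσ with
    | one => exact .refl
    | @step σ u v _ hadj hb ih =>
      by_cases heq : f (σ u) = f (σ v)
      · convert ih using 1
        ext q
        simp only [Function.comp_apply, Perm.mul_apply, swap_apply_def]
        split_ifs <;> simp_all
      · exact ih.tail ⟨u, v, hadj, ⟨heq, .inl hb⟩, (update_update_eq_comp_swap (f ∘ σ) u v).symm⟩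

/-- `Conn G D a b`: some walk of `G` from `a` to `b` stays inside `D`. -/
def Conn (G : SimpleGraph V) (D : Set V) (a b : V) : Prop :=
  ∃ p : G.Walk a b, ∀ x ∈ p.support, x ∈ D

namespace Conn

variable {G : SimpleGraph V} {D : Set V} {a b c : V}

omit [DecidableEq V]

lemma refl (ha : a ∈ D) : Conn G D a a := ⟨.nil, by simpa using ha⟩

lemma symm (h : Conn G D a b) : Conn G D b a := by
  obtain ⟨p, hp⟩ := h
  exact ⟨p.reverse, by simpa using hp⟩

lemma trans (h : Conn G D a b) (h' : Conn G D b c) : Conn G D a c := by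
  obtain ⟨p, hp⟩ := h
  obtain ⟨q, hq⟩ := h'
  exact ⟨p.append q, by simp only [Walk.mem_support_append_iff]; grind⟩

lemma of_adj (h : G.Adj a b) (ha : a ∈ D) (hb : b ∈ D) : Conn G D a b :=
  ⟨h.toWalk, by simp [Adj.toWalk, ha, hb]⟩

lemma left_mem (h : Conn G D a b) : a ∈ D := by
  obtain ⟨p, hp⟩ := h
  exact hp _ p.start_mem_support

lemma right_mem (h : Conn G D a b) : b ∈ D := h.symm.left_mem

/-- Walking from outside `Z` to a vertex of `Z`, there is an edge entering `Z`. -/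
lemma exists_entering {Z : Set V} (h : Conn G D a b) (ha : a ∉ Z) (hb : b ∈ Z) :
    ∃ z w, z ∉ Z ∧ w ∈ Z ∧ G.Adj z w ∧ w ∈ D ∧ Conn G (D \ Z) a z := by
  obtain ⟨p, hp⟩ := h
  induction p with
  | nil => exact absurd hb ha
  | @cons a x b hadj p ih =>
    simp only [Walk.support_cons, List.mem_cons, forall_eq_or_imp] at hp
    have hx : x ∈ D := hp.2 _ p.start_mem_support
    by_cases hxZ : x ∈ Z
    · exact ⟨a, x, ha, hxZ, hadj, hx, .refl ⟨hp.1, ha⟩⟩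
    · obtain ⟨z, w, hz, hw, hzw, hwD, hc⟩ := ih hxZ hb hp.2
      exact ⟨z, w, hz, hw, hzw, hwD, (of_adj (D := D \ Z) hadj ⟨hp.1, ha⟩ ⟨hx, hxZ⟩).trans hc⟩

end Conn

/-- Moving a blank along a walk inside `D`, the blanks on the way being indistinguishable. -/
lemma exists_legal_of_conn {G : SimpleGraph V} {D : Set V} {x y : V} (h : Conn G D x y)
    (A : Set V) :
    ∃ τ, Legal (restr G D) A τ ∧ (∀ q ∉ D, τ q = q) ∧ ∀ q, τ q ∈ A ↔ swap x y q ∈ A := by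
  obtain ⟨p, hp⟩ := h
  induction p generalizing A with
  | nil => exact ⟨1, .one, by simp, by simp⟩
  | @cons a x b hadj p ih =>
    simp only [Walk.support_cons, List.mem_cons, forall_eq_or_imp] at hp
    have haD := hp.1
    have hxD : x ∈ D := hp.2 _ p.start_mem_support
    have hadj' : (restr G D).Adj a x := ⟨hadj, haD, hxD⟩
    have hstep : ∀ A' : Set V, ∃ τ, Legal (restr G D) A' τ ∧ (∀ q ∉ D, τ q = q) ∧
        ∀ q, τ q ∈ A' ↔ swap a x q ∈ A' := by
      intro A'
      by_cases ha : a ∈ A' ∨ x ∈ A'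
      · refine ⟨swap a x, ?_, fun q hq => swap_apply_of_ne_of_ne ?_ ?_, fun q => Iff.rfl⟩
        · rcases ha with ha | ha
          · exact .of_adj hadj' ha
          · rw [swap_comm]; exact .of_adj hadj'.symm ha
        all_goals rintro rfl; exact hq ‹_›
      · push Not at ha
        refine ⟨1, .one, by simp, fun q => ?_⟩
        rw [swap_apply_def]
        split_ifs <;> simp_all
    by_cases hab : a = b
    · subst hab
      exact ⟨1, .one, by simp, by simp⟩
    by_cases hxb : x = b
    · subst hxb
      exact hstep A
    obtain ⟨τ₁, h1, h1', h1''⟩ := hstep A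
    obtain ⟨τ₂, h2, h2', h2''⟩ := ih {q | τ₁ q ∈ A} hp.2
    obtain ⟨τ₃, h3, h3', h3''⟩ := hstep {q | (τ₁ * τ₂) q ∈ A}
    refine ⟨τ₁ * τ₂ * τ₃, (h1.mul h2).mul h3, fun q hq => by
      simp [h1' q hq, h2' q hq, h3' q hq], fun q => ?_⟩
    have e : swap a x * swap x b * swap a x = swap a b := by
      ext q
      simp only [Perm.mul_apply, swap_apply_def]
      have := hadj.ne
      split_ifs <;> simp_all
    have h3q := h3'' q
    have h2q := h2'' (swap a x q)
    simp only [Set.mem_ofPred_eq, Perm.mul_apply] at h3q h2q ⊢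
    rw [h3q, h2q, h1'', ← e]
    rfl

/-- If `D` is connected, then blanks can be brought into any position within `D`. -/
lemma exists_legal_regather [Fintype V] {G : SimpleGraph V} {D : Set V}
    (hD : ∀ x ∈ D, ∀ y ∈ D, Conn G D x y) (A B : Finset V) (hcard : A.card = B.card)
    (hAB : ∀ q ∉ D, q ∈ A ↔ q ∈ B) :
    ∃ τ, Legal G (A : Set V) τ ∧ (∀ q ∉ D, τ q = q) ∧ ∀ q, τ q ∈ A ↔ q ∈ B := by
  induction hn : (A \ B).card generalizing A with
  | zero =>
    have hs : A ⊆ B := by simpa using hn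
    obtain rfl := Finset.eq_of_subset_of_card_le hs hcard.ge
    exact ⟨1, .one, by simp, by simp⟩
  | succ n ih =>
    obtain ⟨x, hx⟩ : (A \ B).Nonempty := by rw [← Finset.card_pos]; omega
    obtain ⟨y, hy⟩ : (B \ A).Nonempty := by
      rw [← Finset.card_pos, ← Finset.card_sdiff_comm hcard]; omega
    rw [Finset.mem_sdiff] at hx hy
    have hxD : x ∈ D := by by_contra h; exact hx.2 ((hAB x h).1 hx.1)
    have hyD : y ∈ D := by by_contra h; exact hy.2 ((hAB y h).2 hy.1)
    obtain ⟨τ, h1, h2, h3⟩ := exists_legal_of_conn (hD x hxD y hyD) (A : Set V)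
    have hmem : ∀ q, q ∈ insert y (A.erase x) ↔ swap x y q ∈ A := by
      intro q
      rw [swap_apply_def]
      simp only [Finset.mem_insert, Finset.mem_erase]
      split_ifs <;> grind
    have hA' : {q | τ q ∈ (A : Set V)} = ((insert y (A.erase x) : Finset V) : Set V) := by
      ext q
      rw [Set.mem_ofPred_eq, h3, Finset.mem_coe, Finset.mem_coe, hmem]
    have hdiff : insert y (A.erase x) \ B = (A \ B).erase x := by
      ext q
      simp only [Finset.mem_sdiff, Finset.mem_insert, Finset.mem_erase]
      by_cases hqy : q = y
      · subst hqy; simp [hy.1]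
      · tauto
    obtain ⟨τ', h1', h2', h3'⟩ := ih (insert y (A.erase x))
      (by rw [Finset.card_insert_of_notMem (by simp [hy.2]), Finset.card_erase_add_one hx.1, hcard])
      (fun q hq => by
        rw [hmem, swap_apply_of_ne_of_ne (ne_of_mem_of_not_mem hxD hq).symm
          (ne_of_mem_of_not_mem hyD hq).symm]
        exact hAB q hq)
      (by rw [hdiff, Finset.card_erase_of_mem (by simp [hx]), hn]; rfl)
    refine ⟨τ * τ', (h1.mono (restr_le _ _) subset_rfl).mul (hA' ▸ h1'), fun q hq => by
      simp [h2 q hq, h2' q hq], fun q => ?_⟩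
    have := h3 (τ' q)
    rw [Finset.mem_coe, Finset.mem_coe, ← hmem, h3'] at this
    simpa using this

/-- Around a vertex `w` with three neighbours, two blanks let the other two tokens be exchanged. -/
lemma Legal.claw {G : SimpleGraph V} {A : Set V} {w a b z : V} (hwa : G.Adj w a)
    (hwb : G.Adj w b) (hwz : G.Adj w z) (hab : a ≠ b) (haz : a ≠ z) (hbz : b ≠ z)
    (hw : w ∈ A) (hz : z ∈ A) : Legal G A (swap a b) := by
  have h1 := hwa.ne
  have h2 := hwb.ne
  have h3 := hwz.ne
  have := (((((((Legal.one (G := G) (A := A)).step' hwa.symm (by simpa)).step' hwz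
    (by simp [swap_apply_def, *]; grind)).step' hwb.symm (by simp [swap_apply_def]; grind)).step'
    hwa (by simp [swap_apply_def]; grind)).step' hwz.symm (by simp [swap_apply_def]; grind)).step'
    hwb (by simp [swap_apply_def]; grind)).step' hwz (by simp [swap_apply_def]; grind)
  convert this using 1
  ext q
  simp only [Perm.mul_apply, Perm.one_apply, swap_apply_def]
  grind

/-- A cycle with one blank vertex `w` and another blank next to it: all tokens on the cycle can be
exchanged. -/
lemma Legal.swap_of_isCycle_of_adj {G : SimpleGraph V} {A : Set V} {w z : V} {c : G.Walk w w}
    (hc : c.IsCycle) (hzw : G.Adj z w) (hz : z ∉ c.support) (hwA : w ∈ A) (hzA : z ∈ A)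
    {i j : V} (hi : i ∈ c.support) (hj : j ∈ c.support) (hiA : i ∉ A) (hjA : j ∉ A) :
    Legal G A (swap i j) := by
  set n := c.length with hn
  have hn3 : 3 ≤ n := hc.three_le_length
  set x : ℕ → V := c.getVert with hx
  have hx0 : x 0 = w := by simp [hx]
  have hxn : x n = w := by simp [hx, hn]
  have hinj : ∀ i < n, ∀ j < n, x i = x j → i = j := fun i hi j hj h =>
    hc.getVert_injOn' (by simp; omega) (by simp; omega) h
  have hadj : ∀ i < n, G.Adj (x i) (x (i + 1)) := fun i hi => c.adj_getVert_succ hi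
  have hxz : ∀ i, x i ≠ z := fun i h => hz (h ▸ c.getVert_mem_support i)
  have hβ : ∀ k < n, ∃ β, Legal G {w} β ∧ (∀ i < k, β (x i) = x (i + 1)) ∧ β (x k) = w ∧
      ∀ q, (∀ i ≤ k, q ≠ x i) → β q = q := by
    intro k
    induction k with
    | zero => exact fun _ => ⟨1, .one, by simp, by simp [hx0], by simp⟩
    | succ k ih =>
      intro hk
      obtain ⟨β, h1, h2, h3, h4⟩ := ih (by omega)
      refine ⟨β * swap (x k) (x (k + 1)), h1.step (hadj k (by omega)) (by simp [h3]), ?_,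
        by simp [h3], fun q hq => ?_⟩
      · intro i hik
        rcases Nat.lt_succ_iff_lt_or_eq.1 hik with hik | rfl
        · have e1 : x i ≠ x k := fun h => by have := hinj i (by omega) k (by omega) h; omega
          have e2 : x i ≠ x (k + 1) := fun h => by
            have := hinj i (by omega) (k + 1) (by omega) h; omega
          simp [swap_apply_of_ne_of_ne e1 e2, h2 i hik]
        · simp only [Perm.mul_apply, swap_apply_left]
          exact h4 _ fun l hl h => by have := hinj _ (by omega) _ (by omega) h; omega
      · rw [Perm.mul_apply, swap_apply_of_ne_of_ne (hq k (by omega)) (hq (k + 1) le_rfl)]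
        exact h4 q fun i hi => hq i (by omega)
  obtain ⟨β, h1, h2, h3, h4⟩ := hβ (n - 1) (by omega)
  have hlast : G.Adj (x (n - 1)) w := by
    have := hadj (n - 1) (by omega)
    rwa [Nat.sub_add_cancel (by omega), hxn] at this
  set ρ := β * swap (x (n - 1)) w with hρ
  have hρl : Legal G {w} ρ := h1.step hlast (by simp [h3])
  have hxw : ∀ i, 1 ≤ i → i < n → x i ≠ w := fun i h1 h2 h => by
    have := hinj i h2 0 (by omega) (h.trans hx0.symm); omega
  have hρw : ρ w = w := by simp [hρ, h3]
  have hρz : ρ z = z := by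
    rw [hρ, Perm.mul_apply, swap_apply_of_ne_of_ne (hxz _).symm hzw.ne]
    exact h4 z fun i _ => (hxz i).symm
  have hρi : ∀ i, 1 ≤ i → i + 1 < n → ρ (x i) = x (i + 1) := fun i hi1 hi2 => by
    have e1 : x i ≠ x (n - 1) := fun h => by
      have := hinj i (by omega) (n - 1) (by omega) h; omega
    rw [hρ, Perm.mul_apply, swap_apply_of_ne_of_ne e1 (hxw i hi1 (by omega)), h2 i (by omega)]
  have hρn : ρ (x (n - 1)) = x 1 := by
    rw [hρ, Perm.mul_apply, swap_apply_left, ← hx0, h2 0 (by omega)]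
  have hρA : {q | ρ q ∈ ({w, z} : Set V)} = {w, z} := by
    ext q
    simp only [Set.mem_ofPred_eq, Set.mem_insert_iff, Set.mem_singleton_iff]
    rw [← ρ.injective.eq_iff (a := q) (b := w), ← ρ.injective.eq_iff (a := q) (b := z), hρw, hρz]
  have hρl' : Legal G {w, z} ρ := hρl.mono le_rfl (by simp)
  have hmem : ∀ i, 1 ≤ i → i < n → x i ∉ ({w, z} : Set V) := fun i h1 h2 => by
    simp [hxw i h1 h2, hxz i]
  have hconj : ∀ a b, a ∉ ({w, z} : Set V) → b ∉ ({w, z} : Set V) →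
      Legal G {w, z} (swap a b) → Legal G {w, z} (swap (ρ a) (ρ b)) := fun a b ha hb h =>
    hρl'.conj_swap (by rwa [hρA]) (by rw [← hρA] at ha; exact ha) (by rw [← hρA] at hb; exact hb)
  have hclaw : Legal G {w, z} (swap (x (n - 1)) (x 1)) :=
    Legal.claw (w := w) (z := z) hlast.symm (by simpa [hx0] using hadj 0 (by omega)) hzw.symm
      (fun h => by have := hinj _ (by omega) _ (by omega) h; omega) (hxz _) (hxz _)
      (by simp) (by simp)
  have hsucc : ∀ k, 1 ≤ k → k + 1 < n → Legal G {w, z} (swap (x k) (x (k + 1))) := by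
    intro k hk
    induction k, hk using Nat.le_induction with
    | base =>
      intro h
      have := hconj _ _ (hmem _ (by omega) (by omega)) (hmem _ le_rfl (by omega)) hclaw
      rwa [hρn, hρi 1 le_rfl h] at this
    | succ k hk ih =>
      intro h
      have := hconj _ _ (hmem k hk (by omega)) (hmem (k + 1) (by omega) (by omega)) (ih (by omega))
      rwa [hρi k hk (by omega), hρi (k + 1) (by omega) h] at this
  have hone : ∀ k, 1 ≤ k → k < n → Legal G {w, z} (swap (x 1) (x k)) := by
    intro k hk
    induction k, hk using Nat.le_induction with
    | base => intro _; rw [swap_self]; exact .one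
    | succ k hk ih =>
      intro h
      exact Legal.swap_trans (hmem 1 le_rfl (by omega)) (hmem k hk (by omega))
        (hmem _ (by omega) h) (ih (by omega)) (hsucc k hk h)
  have hidx : ∀ i ∈ c.support, i ∉ A → ∃ k, 1 ≤ k ∧ k < n ∧ i = x k := by
    intro i hi hiA
    obtain ⟨k, rfl, hk⟩ := Walk.mem_support_iff_exists_getVert.1 hi
    have h0 : k ≠ 0 := by rintro rfl; exact hiA (by simpa using hwA)
    have hn' : k ≠ n := by rintro rfl; exact hiA (by rw [← hxn] at hwA; exact hwA)
    exact ⟨k, by omega, by omega, rfl⟩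
  obtain ⟨k, hk1, hk2, rfl⟩ := hidx i hi hiA
  obtain ⟨l, hl1, hl2, rfl⟩ := hidx j hj hjA
  refine Legal.mono (A := {w, z}) ?_ le_rfl (by
    rintro q (rfl | rfl)
    exacts [hwA, hzA])
  refine Legal.swap_trans (hmem k hk1 hk2) (hmem 1 le_rfl (by omega)) (hmem l hl1 hl2) ?_
    (hone l hl1 hl2)
  rw [swap_comm]
  exact hone k hk1 hk2

omit [DecidableEq V] in
lemma Conn.of_reachable {G : SimpleGraph V} {a b : V} (h : G.Reachable a b) :
    Conn G Set.univ a b := ⟨h.some, by simp⟩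

lemma Conn.of_mem_support {G : SimpleGraph V} {v : V} {c : G.Walk v v} {a b : V}
    (ha : a ∈ c.support) (hb : b ∈ c.support) : Conn G {q | q ∈ c.support} a b := by
  have hb' : b ∈ (c.rotate a ha).support := (Walk.mem_support_rotate_iff _ _ _).2 hb
  exact ⟨(c.rotate a ha).takeUntil b hb', fun x hx =>
    (Walk.mem_support_rotate_iff _ _ ha).1 (Walk.support_takeUntil_subset_support _ _ hx)⟩

omit [DecidableEq V] in
lemma inv_apply_mem {τ : Perm V} {D : Set V} (h : ∀ q ∉ D, τ q = q) {i : V} (hi : i ∈ D) :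
    τ⁻¹ i ∈ D := by
  by_contra h'
  have := h _ h'
  rw [(Perm.eq_inv_iff_eq.1 rfl : τ (τ⁻¹ i) = i)] at this
  exact h' (this ▸ hi)

/-- A cycle carrying a blank, with another blank on a neighbour outside of the cycle. -/
lemma Legal.swap_of_isCycle_of_entering {G : SimpleGraph V} {A : Set V} {v y w z : V}
    {c : G.Walk v v} (hc : c.IsCycle) (hy : y ∈ c.support) (hyA : y ∈ A) (hw : w ∈ c.support)
    (hz : z ∉ c.support) (hzw : G.Adj z w) (hzA : z ∈ A)
    {i j : V} (hi : i ∈ c.support) (hj : j ∈ c.support) (hiA : i ∉ A) (hjA : j ∉ A) :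
    Legal G A (swap i j) := by
  obtain ⟨τ, h1, h2, h3⟩ := exists_legal_of_conn (Conn.of_mem_support hy hw) A
  refine Legal.conj_swap' (h1.mono (restr_le _ _) subset_rfl) hiA hjA ?_
  have hi' : τ⁻¹ i ∈ c.support := inv_apply_mem h2 hi
  have hj' : τ⁻¹ j ∈ c.support := inv_apply_mem h2 hj
  exact Legal.swap_of_isCycle_of_adj (hc.rotate hw) hzw
    (by rwa [Walk.mem_support_rotate_iff]) (by simpa [h3] using hyA)
    (by rw [Set.mem_ofPred_eq, h2 z hz]; exact hzA)
    (by rwa [Walk.mem_support_rotate_iff]) (by rwa [Walk.mem_support_rotate_iff])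
    (by simpa) (by simpa)

/-- A cycle carrying a blank and missing some vertex of its component: all tokens on the cycle can
be exchanged as soon as the component has another blank. -/
lemma Legal.swap_of_isCycle {G : SimpleGraph V} {A : Set V} {v y y' o : V}
    {c : G.Walk v v} (hc : c.IsCycle) (hy : y ∈ c.support) (hyA : y ∈ A) (hyA' : y' ∈ A)
    (hne : y' ≠ y) (hyr : G.Reachable y' y) (ho : o ∉ c.support) (hor : G.Reachable o y)
    {i j : V} (hi : i ∈ c.support) (hj : j ∈ c.support) (hiA : i ∉ A) (hjA : j ∉ A) :
    Legal G A (swap i j) := by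
  by_cases hyc : y' ∈ c.support
  · obtain ⟨z, w, hz, hw, hzw, -, -⟩ :=
      (Conn.of_reachable hor).exists_entering (Z := {q | q ∈ c.support}) ho hy
    obtain ⟨τ, h1, h2, h3⟩ := exists_legal_of_conn (Conn.of_mem_support hy hw) A
    have hτw : τ w ∈ A := by simpa [h3] using hyA
    have hne' : swap y w y' ≠ w := by
      rw [Ne, ← (swap y w).injective.eq_iff]; simpa using hne
    have hmem : swap y w y' ∈ c.support := by
      rw [swap_apply_def]; split_ifs <;> assumption
    have hzne : ∀ q ∈ c.support, q ≠ z := fun q hq h => hz (h ▸ hq)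
    have hfix : ∀ q ∈ c.support, q ∉ A → swap w z (τ⁻¹ q) = τ⁻¹ q := fun q hq hqA =>
      swap_apply_of_ne_of_ne (fun h => hqA (by rw [← h] at hτw; simpa using hτw))
        (hzne _ (inv_apply_mem h2 hq))
    refine Legal.conj_swap' (σ := τ * swap w z)
      ((h1.mono (restr_le _ _) subset_rfl).step hzw.symm hτw) hiA hjA ?_
    rw [mul_inv_rev, swap_inv, Perm.mul_apply, Perm.mul_apply, hfix i hi hiA, hfix j hj hjA]
    refine Legal.swap_of_isCycle_of_entering hc hmem ?_ hw hz hzw (by simpa)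
      (inv_apply_mem h2 hi) (inv_apply_mem h2 hj) ?_ ?_
    · rw [Set.mem_ofPred_eq, Perm.mul_apply, swap_apply_of_ne_of_ne hne' (hzne _ hmem), h3]
      simpa
    · rw [Set.mem_ofPred_eq, Perm.mul_apply, hfix i hi hiA]; simpa
    · rw [Set.mem_ofPred_eq, Perm.mul_apply, hfix j hj hjA]; simpa
  · obtain ⟨z, w, hz, hw, hzw, -, hc'⟩ :=
      (Conn.of_reachable hyr).exists_entering (Z := {q | q ∈ c.support}) hyc hy
    obtain ⟨τ, h1, h2, h3⟩ := exists_legal_of_conn hc' A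
    have hfix : ∀ q ∈ c.support, τ q = q := fun q hq => h2 q fun h => h.2 hq
    have hfix' : ∀ q ∈ c.support, τ⁻¹ q = q := fun q hq => by
      rw [Perm.inv_eq_iff_eq, hfix q hq]
    refine Legal.conj_swap' (h1.mono (restr_le _ _) subset_rfl) hiA hjA ?_
    rw [hfix' i hi, hfix' j hj]
    exact Legal.swap_of_isCycle_of_entering hc hy (by simpa [hfix y hy]) hw hz hzw
      (by simpa [h3]) hi hj (by simpa [hfix i hi]) (by simpa [hfix j hj])

section Moves

variable {α : Type*} {e : α}

/-- Contents `e` meaning blank: the content of some vertex moves to a blank neighbour. -/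
def Mv (e : α) (H : SimpleGraph V) (c c' : V → α) : Prop :=
  ∃ a b, H.Adj a b ∧ c b = e ∧ c' = c ∘ swap a b

/-- Reachability by moves. -/
abbrev Mvs (e : α) (H : SimpleGraph V) : (V → α) → (V → α) → Prop :=
  Relation.ReflTransGen (Mv e H)

variable {H H' : SimpleGraph V} {c c' : V → α}

lemma Mv.symm (h : Mv e H c c') : Mv e H c' c := by
  obtain ⟨a, b, hab, hb, rfl⟩ := h
  refine ⟨b, a, hab.symm, by simpa, ?_⟩
  ext q
  simp [swap_comm b a]

lemma Mvs.symm (h : Mvs e H c c') : Mvs e H c' c := by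
  induction h with
  | refl => exact .refl
  | tail _ hs ih => exact .head hs.symm ih

lemma Mvs.mono (h : Mvs e H c c') (hH : H ≤ H') : Mvs e H' c c' := by
  induction h with
  | refl => exact .refl
  | tail _ hs ih =>
    obtain ⟨a, b, hab, h⟩ := hs
    exact ih.tail ⟨a, b, hH hab, h⟩

lemma Mvs.of_legal {σ : Perm V} (h : Legal H {q | c q = e} σ) : Mvs e H c (c ∘ σ) := by
  induction h with
  | one => exact .refl
  | @step σ u v _ hadj hb ih =>
    exact ih.tail ⟨v, u, hadj.symm, hb, by rw [swap_comm]; rfl⟩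

omit [DecidableEq V] in
lemma restr_mono {S S' : Set V} (h : S ⊆ S') : restr H S ≤ restr H S' :=
  fun _ _ hab => ⟨hab.1, h hab.2.1, h hab.2.2⟩

/-- Contents can be exchanged along a path on which all tokens look the same. -/
lemma Mvs.of_conn {D : Set V} {x y : V} (h : Conn H D x y) (κ : α)
    (hD : ∀ q ∈ D, c q = κ ∨ c q = e) : Mvs e (restr H D) c (c ∘ swap x y) := by
  obtain ⟨τ, h1, h2, h3⟩ := exists_legal_of_conn h {q | c q = e}
  convert Mvs.of_legal h1 using 1
  ext q
  have hx := h.left_mem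
  have hy := h.right_mem
  simp only [Function.comp_apply]
  by_cases hq : q ∈ D
  · have m1 : swap x y q ∈ D := by rw [swap_apply_def]; split_ifs <;> assumption
    have m2 : τ q ∈ D := by simpa using inv_apply_mem (τ := τ⁻¹) (D := D) (fun q hq => by
      rw [Perm.inv_eq_iff_eq, h2 q hq]) hq
    have h3 := h3 q
    simp only [Set.mem_ofPred_eq] at h3
    rcases hD _ m1 with h | h <;> rcases hD _ m2 with h' | h' <;> grind
  · rw [h2 q hq, swap_apply_of_ne_of_ne]
    all_goals rintro rfl; exact hq ‹_›

omit [DecidableEq V] in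
lemma Conn.of_seq {D : Set V} {x : ℕ → V} {i j : ℕ} (hij : i ≤ j)
    (hadj : ∀ k, i ≤ k → k < j → H.Adj (x k) (x (k + 1)))
    (hD : ∀ k, i ≤ k → k ≤ j → x k ∈ D) : Conn H D (x i) (x j) := by
  induction j, hij using Nat.le_induction with
  | base => exact .refl (hD _ le_rfl le_rfl)
  | succ j hij ih =>
    exact (ih (fun k h1 h2 => hadj k h1 (by omega)) fun k h1 h2 => hD k h1 (by omega)).trans
      (.of_adj (hadj j hij (by omega)) (hD j hij (by omega)) (hD _ (by omega) le_rfl))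

omit [DecidableEq V] in
/-- A finite nonempty set of vertices of a forest has a vertex with at most one neighbour in it. -/
lemma exists_leaf [Fintype V] {T : SimpleGraph V} (hT : T.IsAcyclic) {S : Set V}
    (hS : S.Nonempty) :
    ∃ l ∈ S, ∀ r ∈ S, ∀ r' ∈ S, T.Adj l r → T.Adj l r' → r = r' := by
  classical
  let P : ℕ → Prop := fun n => ∃ l v, ∃ p : T.Walk l v, p.IsPath ∧ (∀ q ∈ p.support, q ∈ S) ∧
    p.length = n
  have hP0 : P 0 := ⟨hS.some, hS.some, .nil, by simp, by simpa using hS.some_mem, rfl⟩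
  obtain ⟨l, v, p, hp, hpS, hlen⟩ := Nat.findGreatest_spec (Nat.zero_le (Fintype.card V)) hP0
  have key : ∀ r ∈ S, T.Adj l r → r = p.snd := by
    intro r hr hlr
    by_cases hrp : r ∈ p.support
    · exact hT.eq_snd_of_adj_start hp hlr hrp
    · exfalso
      have hp' : (Walk.cons hlr.symm p).IsPath := by simp [hp, hrp]
      have : P (p.length + 1) := ⟨r, v, Walk.cons hlr.symm p, hp', by simpa [hr] using hpS, by simp⟩
      have hle := Nat.le_findGreatest (hp'.length_lt.le.trans' (by simp)) this
      omega
  exact ⟨l, hpS _ p.start_mem_support, fun r hr r' hr' h h' =>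
    (key r hr h).trans (key r' hr' h').symm⟩

end Moves

section Forest

variable {α : Type*} {e : α} {T : SimpleGraph V} {S : Set V} {l : V} {c c' d : V → α}

/-- The token on `v` is the first one on some path inside `S` starting from the blank vertex `l`. -/
def Vis (e : α) (T : SimpleGraph V) (S : Set V) (l : V) (c : V → α) (v : V) : Prop :=
  c v ≠ e ∧ ∃ (n : ℕ) (x : ℕ → V), 1 ≤ n ∧ x 0 = l ∧ x n = v ∧
    (∀ i < n, T.Adj (x i) (x (i + 1))) ∧ (∀ i ≤ n, ∀ j ≤ n, x i = x j → i = j) ∧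
    (∀ i ≤ n, x i ∈ S) ∧ ∀ i < n, c (x i) = e

omit [DecidableEq V] in
lemma Vis.congr {v : V} (h : Vis e T S l c v) (hcc : ∀ q, c q = e ↔ c' q = e) :
    Vis e T S l c' v := by
  obtain ⟨hv, n, x, h1, h2, h3, h4, h5, h6, h7⟩ := h
  exact ⟨fun h => hv ((hcc v).2 h), n, x, h1, h2, h3, h4, h5, h6, fun i hi => (hcc _).1 (h7 i hi)⟩

lemma Vis.mvs {v : V} (h : Vis e T S l c v) : Mvs e (restr T S) c (c ∘ swap l v) := by
  obtain ⟨hv, n, x, h1, rfl, rfl, h4, h5, h6, h7⟩ := h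
  refine (Mvs.of_conn (D := {q | ∃ i ≤ n, x i = q}) (Conn.of_seq (Nat.zero_le n)
    (fun k _ hk => h4 k hk) fun k _ hk => ⟨k, hk, rfl⟩) (c (x n)) ?_).mono (restr_mono ?_)
  · rintro _ ⟨i, hi, rfl⟩
    rcases hi.lt_or_eq with hi | rfl
    · exact .inr (h7 i hi)
    · exact .inl rfl
  · rintro _ ⟨i, hi, rfl⟩
    exact h6 i hi

/-- Exchanging two tokens next to a blank vertex having another blank neighbour
does not change the contents. -/
def ClawMono (e : α) (T : SimpleGraph V) (X : Set (V → α)) : Prop :=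
  ∀ c ∈ X, ∀ w a b z, T.Adj w a → T.Adj w b → T.Adj w z → a ≠ b → a ≠ z → b ≠ z →
    c w = e → c z = e → c a ≠ e → c b ≠ e → c a = c b

variable {X : Set (V → α)}

lemma Mvs.mem (hX : ∀ c ∈ X, ∀ c', Mv e T c c' → c' ∈ X) (h : Mvs e T c c') (hc : c ∈ X) :
    c' ∈ X := by
  induction h with
  | refl => exact hc
  | tail _ hs ih => exact hX _ ih _ hs

lemma comp_swap_eq_self {a b : V} (h : c a = c b) : c ∘ swap a b = c := by
  ext q
  simp only [Function.comp_apply, swap_apply_def]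
  split_ifs <;> simp_all

lemma Vis.step (hX : ∀ c ∈ X, ∀ c', Mv e T c c' → c' ∈ X) (hclaw : ClawMono e T X)
    (hc : c ∈ X) (hl : c l = e) {v a b : V} (hv : Vis e T S l c v) (hab : T.Adj a b)
    (ha : a ∈ S \ {l}) (hb : b ∈ S \ {l}) (hbe : c b = e) :
    ∃ v', Vis e T S l (c ∘ swap a b) v' ∧ (c ∘ swap a b) v' = c v ∧
      Mvs e (restr T (S \ {l})) (c ∘ swap l v) ((c ∘ swap a b) ∘ swap l v') := by
  by_cases hae : c a = e
  · rw [comp_swap_eq_self (hae.trans hbe.symm)]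
    exact ⟨v, hv, rfl, .refl⟩
  obtain ⟨hve, n, x, hn, hx0, hxn, hadj, hinj, hxS, hxe⟩ := hv
  have hal : a ≠ l := ha.2
  have hbl : b ≠ l := hb.2
  have hbv : b ≠ v := by rintro rfl; exact hve hbe
  have hlv : l ≠ v := by rintro rfl; exact hve hl
  have hax : ∀ i < n, x i ≠ a := fun i hi h => hae (h ▸ hxe i hi)
  have hxv : ∀ i < n, x i ≠ v := fun i hi h => hve (h ▸ hxe i hi)
  have hab' := hab.ne
  have htrunc : ∀ m < n, x m = b → (c ∘ swap a b) b = c v → Vis e T S l (c ∘ swap a b) b := by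
    intro m hm hmb hcb
    refine ⟨hcb ▸ hve, m, x, ?_, hx0, hmb, fun i hi => hadj i (by omega),
      fun i hi j hj => hinj i (by omega) j (by omega), fun i hi => hxS i (by omega),
      fun i hi => ?_⟩
    · rcases Nat.eq_zero_or_pos m with rfl | h
      · exact absurd (hmb.symm.trans hx0) hbl
      · exact h
    · have : x i ≠ b := fun h => by
        have := hinj i (by omega) m (by omega) (h.trans hmb.symm); omega
      rw [Function.comp_apply, swap_apply_of_ne_of_ne (hax i (by omega)) this]
      exact hxe i (by omega)
  by_cases hav : a = v
  · subst hav
    have hcb : (c ∘ swap a b) b = c a := by simp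
    refine ⟨b, ?_, hcb, ?_⟩
    · by_cases hbx : ∃ m < n, x m = b
      · obtain ⟨m, hm, hmb⟩ := hbx
        exact htrunc m hm hmb hcb
      · push Not at hbx
        have hbx' : ∀ i ≤ n, x i ≠ b := fun i hi => by
          rcases hi.lt_or_eq with h | rfl
          · exact hbx i h
          · rw [hxn]; exact hab'
        refine ⟨hcb ▸ hve, n + 1, fun i => if i ≤ n then x i else b, by omega, by simp [hx0],
          by simp, fun i hi => ?_, fun i hi j hj h => ?_, fun i hi => ?_, fun i hi => ?_⟩
        · rcases Nat.lt_succ_iff_lt_or_eq.1 hi with h | rfl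
          · simpa [h.le, Nat.succ_le_of_lt h] using hadj i h
          · simpa [hxn] using hab
        · dsimp only at h
          split_ifs at h with h1 h2 h2
          · exact hinj i h1 j h2 h
          · exact absurd h (hbx' i h1)
          · exact absurd h.symm (hbx' j h2)
          · omega
        · dsimp only
          split_ifs with h
          · exact hxS i h
          · exact hb.1
        · have hi' : i ≤ n := by omega
          simp only [hi', if_true, Function.comp_apply]
          rcases hi'.lt_or_eq with h | rfl
          · rw [swap_apply_of_ne_of_ne (hax i h) (hbx i h)]
            exact hxe i h
          · rw [hxn, swap_apply_left]; exact hbe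
    · have : (c ∘ swap a b) ∘ swap l b = c ∘ swap l a := by
        ext q
        simp only [Function.comp_apply, swap_apply_def]
        grind
      rw [this]
  by_cases hbx : ∃ m < n, x m = b
  · obtain ⟨m, hm, hmb⟩ := hbx
    have hm0 : 1 ≤ m := by
      rcases Nat.eq_zero_or_pos m with rfl | h
      · exact absurd (hmb.symm.trans hx0) hbl
      · exact h
    have hav' : ∀ i ≤ n, x i ≠ a := fun i hi => by
      rcases hi.lt_or_eq with h | rfl
      · exact hax i h
      · rw [hxn]; exact Ne.symm hav
    have hxl : ∀ i, m ≤ i → i ≤ n → x i ≠ l := fun i h1 h2 h => by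
      have := hinj i h2 0 (by omega) (h.trans hx0.symm); omega
    have hcv : c a = c v := by
      have hmv : Mvs e T c (c ∘ swap (x (m + 1)) v) := by
        refine (Mvs.of_conn (D := {q | ∃ i, m + 1 ≤ i ∧ i ≤ n ∧ x i = q})
          (by
            rw [← hxn]
            exact Conn.of_seq (x := x) (i := m + 1) (j := n) (by omega) (fun k _ hk => hadj k hk)
              fun k h1 h2 => ⟨k, h1, h2, rfl⟩)
          (c v) ?_).mono (restr_le _ _)
        rintro _ ⟨i, hi1, hi, rfl⟩
        rcases hi.lt_or_eq with hi | rfl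
        · exact .inr (hxe i hi)
        · exact .inl (by rw [hxn])
      have hne : ∀ i ≤ n, ∀ j ≤ n, i ≠ j → x i ≠ x j := fun i hi j hj h h' => h (hinj i hi j hj h')
      have f1 : swap (x (m + 1)) v (x m) = x m :=
        swap_apply_of_ne_of_ne (hne _ (by omega) _ (by omega) (by omega)) (hxv m hm)
      have f2 : swap (x (m + 1)) v (x (m - 1)) = x (m - 1) :=
        swap_apply_of_ne_of_ne (hne _ (by omega) _ (by omega) (by omega)) (hxv _ (by omega))
      have f3 : swap (x (m + 1)) v a = a :=
        swap_apply_of_ne_of_ne (Ne.symm (hav' _ (by omega))) hav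
      have hpred : T.Adj (x m) (x (m - 1)) := by
        have := hadj (m - 1) (by omega)
        rw [Nat.sub_add_cancel hm0] at this
        exact this.symm
      have := hclaw _ (hmv.mem hX hc) (x m) a (x (m + 1)) (x (m - 1)) (hmb ▸ hab.symm)
        (hadj m hm) hpred (Ne.symm (hav' _ (by omega))) (Ne.symm (hav' _ (by omega)))
        (hne _ (by omega) _ (by omega) (by omega))
      simp only [Function.comp_apply, f1, f2, f3, swap_apply_left] at this
      exact this (hxe _ hm) (hxe _ (by omega)) hae hve
    have hcb : (c ∘ swap a b) b = c v := by simpa using hcv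
    refine ⟨b, htrunc m hm hmb hcb, hcb, ?_⟩
    have hconn : Conn T ({a} ∪ {q | ∃ i, m ≤ i ∧ i ≤ n ∧ x i = q}) a v := by
      refine (Conn.of_adj hab (.inl rfl) (.inr ⟨m, le_rfl, hm.le, hmb⟩)).trans ?_
      rw [← hmb, ← hxn]
      exact Conn.of_seq (x := x) hm.le (fun k _ hk => hadj k hk)
        fun k h1 h2 => .inr ⟨k, h1, h2, rfl⟩
    convert Mvs.mono (Mvs.of_conn (e := e) (c := c ∘ swap l v) hconn (c a) ?_)
      (restr_mono ?_) using 1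
    · ext q
      simp only [Function.comp_apply, swap_apply_def]
      grind
    · rintro q (rfl | ⟨i, h1, h2, rfl⟩)
      · left
        rw [Function.comp_apply, swap_apply_of_ne_of_ne hal hav]
      · right
        rcases h2.lt_or_eq with h2 | rfl
        · rw [Function.comp_apply, swap_apply_of_ne_of_ne (hxl i h1 h2.le) (hxv i h2)]
          exact hxe i h2
        · rw [hxn, Function.comp_apply, swap_apply_right]; exact hl
    · rintro q (rfl | ⟨i, h1, h2, rfl⟩)
      · exact ha
      · exact ⟨hxS i h2, hxl i h1 h2⟩
  · push Not at hbx
    have hvv : (c ∘ swap a b) v = c v := by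
      rw [Function.comp_apply, swap_apply_of_ne_of_ne (Ne.symm hav) hbv.symm]
    refine ⟨v, ⟨hvv ▸ hve, n, x, hn, hx0, hxn, hadj, hinj, hxS, fun i hi => ?_⟩, hvv, ?_⟩
    · rw [Function.comp_apply, swap_apply_of_ne_of_ne (hax i hi) (hbx i hi)]
      exact hxe i hi
    · refine Relation.ReflTransGen.single ⟨a, b, ⟨hab, ha, hb⟩, ?_, ?_⟩
      · rw [Function.comp_apply, swap_apply_of_ne_of_ne hbl hbv]; exact hbe
      · ext q
        simp only [Function.comp_apply, swap_apply_def]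
        grind

/-- Following the token initially on the leaf `l`, and pulling it back into `l` at the end. -/
lemma Mvs.leaf_cases (hX : ∀ c ∈ X, ∀ c', Mv e T c c' → c' ∈ X) (hclaw : ClawMono e T X)
    (hleaf : ∀ r ∈ S, ∀ r' ∈ S, T.Adj l r → T.Adj l r' → r = r') (hl : l ∈ S)
    (hd : d ∈ X) (hdl : d l ≠ e) (h : Mvs e (restr T S) d c) :
    (c l = d l ∧ Mvs e (restr T (S \ {l})) d c) ∨
      (c l = e ∧ ∃ v, Vis e T S l c v ∧ c v = d l ∧
        Mvs e (restr T (S \ {l})) d (c ∘ swap l v)) := by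
  induction h with
  | refl => exact .inl ⟨rfl, .refl⟩
  | @tail c c₁ hdc hs ih =>
    obtain ⟨a, b, ⟨hab, ha, hb⟩, hbe, rfl⟩ := hs
    have hc : c ∈ X := Mvs.mem hX (Mvs.mono hdc (restr_le _ _)) hd
    by_cases hae : c a = e
    · rwa [comp_swap_eq_self (hae.trans hbe.symm)]
    rcases ih with ⟨hcl, hm⟩ | ⟨hcl, v, hv, hvd, hm⟩
    · have hbl : b ≠ l := by rintro rfl; exact hdl (hcl ▸ hbe)
      by_cases hal : a = l
      · subst hal
        refine .inr ⟨by simpa using hbe, b, ⟨by simpa using hae, 1, fun i => if i = 0 then a else b,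
          le_rfl, by simp, by simp, fun i hi => ?_, fun i hi j hj h => ?_, fun i _ => ?_,
          fun i hi => ?_⟩, by simpa using hcl, ?_⟩
        · obtain rfl : i = 0 := by omega
          simpa using hab
        · have := hab.ne
          dsimp only at h
          split_ifs at h <;> first | omega | simp_all
        · dsimp only
          split_ifs <;> assumption
        · obtain rfl : i = 0 := by omega
          simpa using hbe
        · have : (c ∘ swap a b) ∘ swap a b = c := by ext q; simp
          rwa [this]
      · refine .inl ⟨?_, hm.tail ⟨a, b, ⟨hab, ⟨ha, hal⟩, ⟨hb, hbl⟩⟩, hbe, rfl⟩⟩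
        rw [Function.comp_apply, swap_apply_of_ne_of_ne (Ne.symm hal) hbl.symm, hcl]
    · have hal : a ≠ l := by rintro rfl; exact hae hcl
      by_cases hbl : b = l
      · subst hbl
        have hva : v = a := by
          obtain ⟨-, n, x, hn, hx0, hxn, hadj, -, hxS, hxe⟩ := hv
          have h1 : x 1 = a := hleaf _ (hxS 1 hn) _ ha (by simpa [hx0] using hadj 0 hn) hab.symm
          have : n = 1 := by
            by_contra h
            exact hae (h1 ▸ hxe 1 (by omega))
          rw [← hxn, this, h1]
        subst hva
        exact .inl ⟨by simpa using hvd, by rwa [swap_comm] at hm⟩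
      · obtain ⟨v', h1, h2, h3⟩ := hv.step hX hclaw hc hcl hab ⟨ha, hal⟩ ⟨hb, hbl⟩ hbe
        refine .inr ⟨?_, v', h1, h2.trans hvd, hm.trans h3⟩
        rw [Function.comp_apply, swap_apply_of_ne_of_ne (Ne.symm hal) (Ne.symm hbl), hcl]

/-- Either the blank vertex `l` is not involved in a motion, or some token visits it. -/
lemma Mvs.visit_cases (hcl : c l = e) (h : Mvs e (restr T S) c c') :
    Mvs e (restr T (S \ {l})) c c' ∨
      ∃ d, d l ≠ e ∧ Mvs e (restr T S) c d ∧ Mvs e (restr T S) d c' := by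
  induction h with
  | refl => exact .inl .refl
  | @tail c' c₁ hcc hs ih =>
    rcases ih with ih | ⟨d, h1, h2, h3⟩
    · by_cases hcl' : c' l = e
      · obtain ⟨a, b, ⟨hab, ha, hb⟩, hbe, rfl⟩ := hs
        by_cases hae : c' a = e
        · exact .inl (by rwa [comp_swap_eq_self (hae.trans hbe.symm)])
        have hal : a ≠ l := by rintro rfl; exact hae hcl'
        by_cases hbl : b = l
        · subst hbl
          exact .inr ⟨_, by simpa using hae, hcc.tail ⟨a, b, ⟨hab, ha, hb⟩, hbe, rfl⟩, .refl⟩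
        · exact .inl (ih.tail ⟨a, b, ⟨hab, ⟨ha, hal⟩, ⟨hb, hbl⟩⟩, hbe, rfl⟩)
      · exact .inr ⟨c', hcl', hcc, .single hs⟩
    · exact .inr ⟨d, h1, h2, h3.tail hs⟩

/-- On a forest, if claws do not distinguish tokens then motions preserving the blank vertices
preserve all contents. -/
lemma Mvs.eq_of_isAcyclic [Fintype V] (hT : T.IsAcyclic)
    (hX : ∀ c ∈ X, ∀ c', Mv e T c c' → c' ∈ X) (hclaw : ClawMono e T X)
    (hc : c ∈ X) (h : Mvs e (restr T S) c c') (hcc : ∀ q, c q = e ↔ c' q = e) : c = c' := by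
  induction hn : S.ncard generalizing S c c' with
  | zero =>
    rw [Set.ncard_eq_zero] at hn
    subst hn
    induction h with
    | refl => rfl
    | tail _ hs => obtain ⟨_, _, h, _⟩ := hs; exact h.2.1.elim
  | succ n ih =>
    obtain ⟨l, hl, hleaf⟩ := exists_leaf hT (S := S) (Set.nonempty_of_ncard_ne_zero (by omega))
    have hn' : (S \ {l}).ncard = n := by rw [Set.ncard_sdiff_singleton_of_mem hl, hn]; rfl
    by_cases hcl : c l = e
    · rcases h.visit_cases hcl with h | ⟨d, hdl, hcd, hdc⟩
      · exact ih hc h hcc hn'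
      · have hd : d ∈ X := (hcd.mono (restr_le _ _)).mem hX hc
        rcases hcd.symm.leaf_cases hX hclaw hleaf hl hd hdl with ⟨h1, -⟩ | ⟨-, v, hv, -, -⟩
        · exact absurd (h1 ▸ hcl) hdl
        have hv' := hv.congr hcc
        have hlv : (c ∘ swap l v) l ≠ e := by simpa using hv.1
        have hlv' : (c' ∘ swap l v) l ≠ e := by simpa using hv'.1
        have hX' : c ∘ swap l v ∈ X := (hv.mvs.mono (restr_le _ _)).mem hX hc
        rcases Mvs.leaf_cases hX hclaw hleaf hl hX' hlv ((hv.mvs.symm.trans h).trans hv'.mvs) with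
          ⟨-, h1⟩ | ⟨h1, -⟩
        · have := ih hX' h1 (fun q => hcc _) hn'
          ext q
          simpa using congrFun this (swap l v q)
        · exact absurd h1 hlv'
    · rcases h.leaf_cases hX hclaw hleaf hl hc hcl with ⟨-, h⟩ | ⟨h, -⟩
      · exact ih hc h hcc hn'
      · exact absurd ((hcc l).2 h) hcl

end Forest

section Component

variable {G : SimpleGraph V} {B K : Set V} {σ : Perm V}

lemma Legal.reachable (h : Legal G B σ) (q : V) : G.Reachable (σ q) q := by
  induction h generalizing q with
  | one => exact .refl _
  | @step σ u v _ hadj _ ih =>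
    refine (ih _).trans ?_
    rw [swap_apply_def]
    split_ifs with h1 h2
    · exact h1 ▸ hadj.symm.reachable
    · exact h2 ▸ hadj.reachable
    · rfl

omit [DecidableEq V] in
lemma mem_iff_of_reachable (hK : ∀ a b, G.Adj a b → (a ∈ K ↔ b ∈ K)) {a b : V}
    (h : G.Reachable a b) : a ∈ K ↔ b ∈ K := by
  obtain ⟨p⟩ := h
  induction p with
  | nil => rfl
  | cons h _ ih => exact (hK _ _ h).trans ih

/-- Forgetting the moves outside a union of components. -/
lemma Legal.restrict (hK : ∀ a b, G.Adj a b → (a ∈ K ↔ b ∈ K)) (h : Legal G B σ) :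
    ∃ τ, Legal (restr G K) (B ∩ K) τ ∧ (∀ q ∈ K, τ q = σ q) ∧ ∀ q ∉ K, τ q = q := by
  induction h with
  | one => exact ⟨1, .one, by simp, by simp⟩
  | @step σ u v hσ hadj hb ih =>
    obtain ⟨τ, h1, h2, h3⟩ := ih
    by_cases hu : u ∈ K
    · have hv := (hK u v hadj).1 hu
      refine ⟨τ * swap u v, h1.step ⟨hadj, hu, hv⟩ (by
        rw [h2 u hu]
        exact ⟨hb, (mem_iff_of_reachable hK (hσ.reachable u)).2 hu⟩), fun q hq => ?_,
        fun q hq => ?_⟩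
      · simp only [Perm.mul_apply, swap_apply_def]
        split_ifs
        exacts [h2 _ hv, h2 _ hu, h2 _ hq]
      · rw [Perm.mul_apply, swap_apply_of_ne_of_ne, h3 q hq]
        all_goals rintro rfl; exact hq ‹_›
    · have hv := fun h => hu ((hK u v hadj).2 h)
      refine ⟨τ, h1, fun q hq => ?_, h3⟩
      rw [Perm.mul_apply, swap_apply_of_ne_of_ne, h2 q hq]
      all_goals rintro rfl; contradiction

/-- The tokens which can be exchanged with `q`. -/
def exchangeable (G : SimpleGraph V) (B : Set V) (q : V) : Set V :=
  {r | q ∉ B ∧ r ∉ B ∧ Legal G B (swap q r)}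

lemma exchangeable_eq_empty {q : V} : exchangeable G B q = ∅ ↔ q ∈ B := by
  constructor
  · intro h
    by_contra hq
    have : q ∈ exchangeable G B q := ⟨hq, hq, by rw [swap_self]; exact .one⟩
    simp [h] at this
  · intro h
    ext r
    simp [exchangeable, h]

lemma exchangeable_congr {q r : V} (hq : q ∉ B) (hr : r ∉ B) (h : Legal G B (swap q r)) :
    exchangeable G B q = exchangeable G B r := by
  ext s
  simp only [exchangeable, Set.mem_ofPred_eq, hq, hr, not_false_eq_true, true_and]
  exact and_congr_right fun hs => ⟨fun h' => .swap_trans hr hq hs (by rwa [swap_comm]) h',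
    fun h' => .swap_trans hq hr hs h h'⟩

lemma legal_swap_of_exchangeable_eq {q r : V} (hq : q ∉ B)
    (h : exchangeable G B q = exchangeable G B r) : Legal G B (swap r q) := by
  have : q ∈ exchangeable G B q := ⟨hq, hq, by rw [swap_self]; exact .one⟩
  rw [h] at this
  exact this.2.2

/-- In a component with two blanks which is not spanned by a cycle, tokens that can replace one
another can be exchanged. -/
lemma Legal.swap_apply_self [Fintype V] (hK : ∀ a b, G.Adj a b → (a ∈ K ↔ b ∈ K))
    (hK' : ∀ a ∈ K, ∀ b ∈ K, G.Reachable a b)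
    (hb : ∃ x ∈ K, ∃ y ∈ K, x ∈ B ∧ y ∈ B ∧ x ≠ y)
    (hcyc : ∀ v ∈ K, ∀ c : G.Walk v v, c.IsCycle → ∃ o ∈ K, o ∉ c.support)
    (hσ : Legal G B σ) (hσB : ∀ q, σ q ∈ B ↔ q ∈ B) {v : V} (hv : v ∈ K) (hvB : v ∉ B) :
    Legal G B (swap (σ v) v) := by
  set X : Set (V → Set V) := {c | ∃ ρ, Legal G B ρ ∧ c = exchangeable G B ∘ ρ} with hX
  have hXG : ∀ c ∈ X, ∀ c', Mv ∅ G c c' → c' ∈ X := by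
    rintro _ ⟨ρ, hρ, rfl⟩ _ ⟨a, b, hab, hbe, rfl⟩
    exact ⟨ρ * swap a b, hρ.step' hab (exchangeable_eq_empty.1 hbe), rfl⟩
  have hconj : ∀ ρ, Legal G B ρ → ∀ a b, ρ a ∉ B → ρ b ∉ B →
      Legal G {q | ρ q ∈ B} (swap a b) → exchangeable G B (ρ a) = exchangeable G B (ρ b) :=
    fun ρ hρ a b ha hb h => exchangeable_congr ha hb (hρ.conj_swap h ha hb)
  obtain ⟨T, hTle, hT, hTr⟩ := (restr G K).exists_isAcyclic_reachable_eq_le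
  have hTG : T ≤ G := hTle.trans (restr_le _ _)
  have hXT : ∀ c ∈ X, ∀ c', Mv ∅ T c c' → c' ∈ X := fun c hc c' ⟨a, b, hab, h⟩ =>
    hXG c hc c' ⟨a, b, hTG hab, h⟩
  have hclaw : ClawMono ∅ T X := by
    rintro _ ⟨ρ, hρ, rfl⟩ w a b z hwa hwb hwz hab haz hbz hw hz ha hb
    simp only [Function.comp_apply, ne_eq, exchangeable_eq_empty] at hw hz ha hb
    exact hconj ρ hρ a b ha hb (.claw (hTG hwa) (hTG hwb) (hTG hwz) hab haz hbz hw hz)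
  have hsim : ∀ c ∈ X, ∀ c', Mv ∅ (restr G K) c c' → Mvs ∅ T c c' := by
    rintro _ ⟨ρ, hρ, rfl⟩ _ ⟨a, b, hab, hbe, rfl⟩
    by_cases hae : (exchangeable G B ∘ ρ) a = ∅
    · rw [comp_swap_eq_self (hae.trans hbe.symm)]
    by_cases hTab : T.Adj a b
    · exact .single ⟨a, b, hTab, hbe, rfl⟩
    have hr : T.Reachable b a := by rw [hTr]; exact hab.symm.reachable
    obtain ⟨p, hp⟩ := hr.exists_isPath
    have hcycle : (Walk.cons hab.1 (p.mapLe hTG)).IsCycle := by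
      rw [Walk.cons_isCycle_iff]
      refine ⟨by simpa using hp, fun h => hTab ?_⟩
      rw [Walk.edges_mapLe_eq_edges] at h
      exact p.adj_of_mem_edges h
    have hsupp : ∀ q ∈ p.support, q ∈ (Walk.cons hab.1 (p.mapLe hTG)).support := fun q hq => by
      simp [hq]
    have hbB : ρ b ∈ B := exchangeable_eq_empty.1 hbe
    have haB : ρ a ∉ B := fun h => hae (exchangeable_eq_empty.2 h)
    obtain ⟨y', hy'K, hy'B, hy'b⟩ : ∃ y' ∈ K, ρ y' ∈ B ∧ y' ≠ b := by
      obtain ⟨x, hx, y, hy, hxB, hyB, hxy⟩ := hb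
      have hmem : ∀ x ∈ K, ρ⁻¹ x ∈ K := fun x hx => by
        have := hρ.reachable (ρ⁻¹ x)
        rw [show ρ (ρ⁻¹ x) = x by simp] at this
        exact (mem_iff_of_reachable hK this).1 hx
      by_cases h : ρ⁻¹ x = b
      · refine ⟨ρ⁻¹ y, hmem y hy, by simpa, fun h' => hxy (ρ⁻¹.injective (h.trans h'.symm))⟩
      · exact ⟨ρ⁻¹ x, hmem x hx, by simpa, h⟩
    obtain ⟨o, hoK, ho⟩ := hcyc a hab.2.1 _ hcycle
    rw [swap_comm]
    refine (Mvs.of_conn (H := T) (D := {q | q ∈ p.support}) ⟨p, fun q hq => hq⟩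
      ((exchangeable G B ∘ ρ) a) fun q hq => ?_).mono (restr_le _ _)
    by_cases hqB : ρ q ∈ B
    · exact .inr (exchangeable_eq_empty.2 hqB)
    · refine .inl (hconj ρ hρ q a hqB haB ?_)
      exact .swap_of_isCycle hcycle (y := b) (y' := y') (hsupp _ p.start_mem_support) hbB hy'B hy'b
        (hK' _ hy'K _ hab.2.2) ho (hK' _ hoK _ hab.2.2) (hsupp _ hq) (hsupp _ p.end_mem_support)
        hqB haB
  have hsims : ∀ c ∈ X, ∀ c', Mvs ∅ (restr G K) c c' → Mvs ∅ T c c' := by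
    intro c hc c' h
    induction h with
    | refl => exact .refl
    | tail _ hs ih => exact ih.trans (hsim _ (ih.mem hXT hc) _ hs)
  obtain ⟨τ, h1, h2, h3⟩ := hσ.restrict hK
  have hc0 : exchangeable G B ∈ X := ⟨1, .one, rfl⟩
  have hm : Mvs ∅ (restr G K) (exchangeable G B) (exchangeable G B ∘ τ) :=
    .of_legal (h1.mono le_rfl fun q hq => exchangeable_eq_empty.2 hq.1)
  have hTm : Mvs ∅ (restr T Set.univ) (exchangeable G B) (exchangeable G B ∘ τ) :=
    (hsims _ hc0 _ hm).mono fun a b hab => ⟨hab, trivial, trivial⟩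
  have heq := hTm.eq_of_isAcyclic hT hXT hclaw hc0 fun q => by
    rw [Function.comp_apply, exchangeable_eq_empty, exchangeable_eq_empty]
    by_cases hq : q ∈ K
    · rw [h2 q hq, hσB]
    · rw [h3 q hq]
  have hv' := congrFun heq v
  rw [Function.comp_apply, h2 v hv] at hv'
  exact legal_swap_of_exchangeable_eq hvB hv'

end Component

section Classes

variable [Fintype V] {G : SimpleGraph V} {f : V → ℕ} {u v : V} {C : Set V}

omit [DecidableEq V] in
lemma exists_fresh (f : V → ℕ) : ∃ c : ℕ, c ≠ 1 ∧ c ∉ Set.range f := by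
  obtain ⟨c, hc⟩ := ((Set.finite_range f).union (Set.finite_singleton 1)).exists_notMem
  rw [Set.mem_union, not_or] at hc
  exact ⟨c, hc.2, hc.1⟩

omit [Fintype V] in
lemma setOf_update_eq_one {c : ℕ} (hu : f u ≠ 1) (hc : c ≠ 1) :
    {q | Function.update f u c q = 1} = {q | f q = 1} := by
  ext q
  by_cases h : q = u
  · subst h; simp [hu, hc]
  · simp [h]

omit [Fintype V] in
lemma update_eq_iff {c : ℕ} (hc : c ∉ Set.range f) {q : V} :
    Function.update f u c q = c ↔ q = u := by
  by_cases h : q = u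
  · simp [h]
  · simpa [h] using fun h => hc ⟨q, h⟩

lemma mem_RSet_iff (hu : f u ≠ 1) :
    v ∈ RSet G f u ↔ ∃ σ, Legal G {q | f q = 1} σ ∧ σ v = u := by
  constructor
  · intro h
    obtain ⟨c, hc1, hc⟩ := exists_fresh f
    obtain ⟨h, hr, hv⟩ := h c hc1 hc
    obtain ⟨σ, hσ, rfl⟩ := reachableConf_iff.1 hr
    rw [setOf_update_eq_one hu hc1] at hσ
    exact ⟨σ, hσ, (update_eq_iff hc).1 hv⟩
  · rintro ⟨σ, hσ, hv⟩ c hc1 hc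
    refine ⟨_, reachableConf_iff.2 ⟨σ, ?_, rfl⟩, (update_eq_iff hc).2 hv⟩
    rwa [setOf_update_eq_one hu hc1]

lemma sim_iff (hu : f u ≠ 1) :
    Sim G f u v ↔ ∃ σ, Legal G {q | f q = 1} σ ∧ σ v = u ∧ ∀ q, f (σ q) = 1 ↔ f q = 1 := by
  have key : ∀ c ≠ 1, ∀ σ : Perm V, {w | (Function.update f u c ∘ σ) w = 1} = {w | f w = 1} ↔
      ∀ q, f (σ q) = 1 ↔ f q = 1 := by
    intro c hc σ
    have := fun q => Set.ext_iff.1 (setOf_update_eq_one (f := f) (u := u) hu hc) q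
    simp only [Set.mem_ofPred_eq] at this
    simp only [Set.ext_iff, Set.mem_ofPred_eq, Function.comp_apply, this]
  constructor
  · intro h
    obtain ⟨c, hc1, hc⟩ := exists_fresh f
    obtain ⟨h, hr, hv, hb⟩ := h c hc1 hc
    obtain ⟨σ, hσ, rfl⟩ := reachableConf_iff.1 hr
    rw [setOf_update_eq_one hu hc1] at hσ
    exact ⟨σ, hσ, (update_eq_iff hc).1 hv, (key c hc1 σ).1 hb⟩
  · rintro ⟨σ, hσ, hv, hb⟩ c hc1 hc
    refine ⟨_, reachableConf_iff.2 ⟨σ, ?_, rfl⟩, (update_eq_iff hc).2 hv, (key c hc1 σ).2 hb⟩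
    rwa [setOf_update_eq_one hu hc1]

omit [Fintype V] in
lemma _root_.IsClass.ne_one (hC : IsClass G f C) (hu : u ∈ C) : f u ≠ 1 := by
  obtain ⟨u₀, -, rfl⟩ := hC
  exact hu.1

lemma _root_.IsClass.exists_legal (hC : IsClass G f C) (hu : u ∈ C) (hv : v ∈ C) :
    ∃ σ, Legal G {q | f q = 1} σ ∧ σ v = u ∧ ∀ q, f (σ q) = 1 ↔ f q = 1 := by
  obtain ⟨u₀, hu₀, rfl⟩ := hC
  obtain ⟨σ, h1, h2, h3⟩ := (sim_iff hu₀).1 hu.2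
  obtain ⟨τ, h1', h2', h3'⟩ := (sim_iff hu₀).1 hv.2
  refine ⟨σ⁻¹ * τ, ?_, by rw [Perm.mul_apply, h2', ← h2]; simp, fun q => ?_⟩
  · have hs := h1.inv
    have e : {q | σ q ∈ {q | f q = 1}} = {q | f q = 1} := by ext q; exact h3 q
    rw [e] at hs
    refine hs.mul (h1'.mono le_rfl fun q hq => ?_)
    rw [Set.mem_ofPred_eq, Set.mem_ofPred_eq, ← h3]
    simpa using hq
  · rw [← h3]
    simpa using h3' q

lemma _root_.IsClass.mem_iff (hC : IsClass G f C) {σ : Perm V} (hσ : Legal G {q | f q = 1} σ)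
    (hb : ∀ q, f (σ q) = 1 ↔ f q = 1) (q : V) : σ q ∈ C ↔ q ∈ C := by
  obtain ⟨u₀, hu₀, rfl⟩ := hC
  have e : {q | σ q ∈ {q | f q = 1}} = {q | f q = 1} := by ext q; exact hb q
  constructor
  · rintro ⟨h, hs⟩
    obtain ⟨τ, h1, h2, h3⟩ := (sim_iff hu₀).1 hs
    refine ⟨fun h' => h ((hb q).2 h'), (sim_iff hu₀).2 ⟨τ * σ, h1.mul ?_, h2, fun q => ?_⟩⟩
    · exact hσ.mono le_rfl fun q hq => (h3 q).2 hq
    · exact (h3 _).trans (hb q)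
  · rintro ⟨h, hs⟩
    obtain ⟨τ, h1, h2, h3⟩ := (sim_iff hu₀).1 hs
    have hi := hσ.inv
    rw [e] at hi
    refine ⟨fun h' => h ((hb q).1 h'), (sim_iff hu₀).2 ⟨τ * σ⁻¹, h1.mul ?_, by simpa using h2,
      fun q => ?_⟩⟩
    · exact hi.mono le_rfl fun q hq => (h3 q).2 hq
    · refine (h3 _).trans ?_
      rw [← hb]
      simp

lemma _root_.IsClass.mem_RC_iff (hC : IsClass G f C) :
    v ∈ RC G f C ↔ ∃ σ, Legal G {q | f q = 1} σ ∧ σ v ∈ C := by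
  simp only [RC, Set.mem_iUnion]
  constructor
  · rintro ⟨u, hu, hv⟩
    obtain ⟨σ, hσ, rfl⟩ := (mem_RSet_iff (hC.ne_one hu)).1 hv
    exact ⟨σ, hσ, hu⟩
  · rintro ⟨σ, hσ, hu⟩
    exact ⟨_, hu, (mem_RSet_iff (hC.ne_one hu)).2 ⟨σ, hσ, rfl⟩⟩

lemma _root_.IsClass.eq_of_mem {C' : Set V} (hC : IsClass G f C) (hC' : IsClass G f C') (hu : u ∈ C)
    (hu' : u ∈ C') : C = C' := by
  ext v
  constructor
  · intro hv
    obtain ⟨σ, h1, h2, h3⟩ := hC.exists_legal hu hv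
    exact (hC'.mem_iff h1 h3 v).1 (h2 ▸ hu')
  · intro hv
    obtain ⟨σ, h1, h2, h3⟩ := hC'.exists_legal hu' hv
    exact (hC.mem_iff h1 h3 v).1 (h2 ▸ hu)

lemma _root_.IsClass.exists_mem (hu : f u ≠ 1) : ∃ C, IsClass G f C ∧ u ∈ C :=
  ⟨_, ⟨u, hu, rfl⟩, hu, (sim_iff hu).2 ⟨1, .one, rfl, fun _ => Iff.rfl⟩⟩

open scoped Classical in
/-- Forgetting all the tokens outside of a class. -/
lemma reachableConf_induce (hC : IsClass G f C) {σ : Perm V} (hσ : Legal G {q | f q = 1} σ) :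
    ReachableConf (G.induce (C ∪ RC G f C)) StarSwap (subConfig f C (C ∪ RC G f C))
      fun x => if σ x ∈ C then f (σ x) else 1 := by
  induction hσ with
  | one => exact .refl
  | @step σ a b hσ hadj hb ih =>
    have ha : σ a ∉ C := fun h => hC.ne_one h hb
    by_cases hbC : σ b ∈ C
    · have hbW : b ∈ C ∪ RC G f C := .inr ((hC.mem_RC_iff).2 ⟨σ, hσ, hbC⟩)
      have haW : a ∈ C ∪ RC G f C :=
        .inr ((hC.mem_RC_iff).2 ⟨σ * swap a b, hσ.step hadj hb, by simpa⟩)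
      refine ih.tail ⟨⟨a, haW⟩, ⟨b, hbW⟩, hadj, ?_, ?_⟩
      · simpa [ha, hbC, StarSwap] using (hC.ne_one hbC).symm
      · rw [update_update_eq_comp_swap]
        ext x
        simp only [Function.comp_apply, Perm.mul_apply, swap_apply_def, Subtype.ext_iff]
        split_ifs <;> simp_all
    · convert ih using 1
      ext x
      have : (σ * swap a b) x ∈ C → (σ * swap a b) x = σ x := by
        simp only [Perm.mul_apply, swap_apply_def]
        split_ifs <;> simp_all
      have h' : σ x ∈ C → (σ * swap a b) x = σ x := by
        simp only [Perm.mul_apply, swap_apply_def]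
        split_ifs <;> simp_all
      by_cases h : (σ * swap a b) x ∈ C
      · rw [this h]
      · have h'' : σ x ∉ C := fun hx => h ((h' hx).symm ▸ hx)
        rw [if_neg h, if_neg h'']

end Classes

section Topology

variable {G : SimpleGraph V} {K D : Set V} {v x : V} {ρ : Perm V}

lemma Conn.of_isCycle {v₀ : V} {c : G.Walk v₀ v₀} (hc : c.IsCycle)
    (hK : ∀ a b, G.Adj a b → (a ∈ K ↔ b ∈ K)) (hcK : ∀ q ∈ K, q ∈ c.support) (hv : v ∈ K)
    {a b : V} (ha : a ∈ K \ {v}) (hb : b ∈ K \ {v}) : Conn G (K \ {v}) a b := by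
  have hvc := hcK v hv
  set d := c.rotate v hvc with hd
  have hdc : d.IsCycle := hc.rotate hvc
  have hidx : ∀ q ∈ K \ {v}, ∃ i, 1 ≤ i ∧ i < d.length ∧ d.getVert i = q := by
    intro q hq
    have : q ∈ d.support := (Walk.mem_support_rotate_iff _ _ hvc).2 (hcK q hq.1)
    obtain ⟨i, rfl, hi⟩ := Walk.mem_support_iff_exists_getVert.1 this
    have h0 : i ≠ 0 := by rintro rfl; exact hq.2 (by simp)
    have h1 : i ≠ d.length := by rintro rfl; exact hq.2 (by simp)
    exact ⟨i, by omega, by omega, rfl⟩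
  have hmem : ∀ i, 1 ≤ i → i < d.length → d.getVert i ∈ K \ {v} := by
    intro i h1 h2
    refine ⟨(mem_iff_of_reachable hK ⟨d.take i⟩).1 hv, fun h => ?_⟩
    have := hdc.getVert_injOn' (x₁ := i) (x₂ := 0) (by simp; omega) (by simp) (by simpa using h)
    omega
  obtain ⟨i, hi1, hi2, rfl⟩ := hidx a ha
  obtain ⟨j, hj1, hj2, rfl⟩ := hidx b hb
  have key : ∀ i j, 1 ≤ i → i ≤ j → j < d.length →
      Conn G (K \ {v}) (d.getVert i) (d.getVert j) := fun i j h1 h2 h3 =>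
    .of_seq h2 (fun k _ hk => d.adj_getVert_succ (by omega)) fun k hk1 hk2 =>
      hmem k (by omega) (by omega)
  rcases le_total i j with h | h
  · exact key i j hi1 h hj2
  · exact (key j i hj1 h hi2).symm

/-- Motion of a single blank `x`, for a set `D` attached to the rest of the graph at `v` only. -/
lemma Legal.mem_iff_of_attached (hv : v ∉ D) (hx : x ∉ D)
    (hD : ∀ a ∈ D, ∀ b, G.Adj a b → b ≠ v → b ∈ D) (h : Legal G {x} ρ) :
    (ρ⁻¹ x ∉ D ∧ ∀ q, ρ q ∈ D ↔ q ∈ D) ∨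
      (ρ⁻¹ x ∈ D ∧ ∀ q, ρ q ∈ D ↔ (q ∈ D ∨ q = v) ∧ q ≠ ρ⁻¹ x) := by
  induction h with
  | one => exact .inl ⟨by simpa, by simp⟩
  | @step ρ u w _ hadj hb ih =>
    have hu : ρ u = x := hb
    have hu' : ρ⁻¹ x = u := by rw [← hu]; simp
    have hw' : (ρ * swap u w)⁻¹ x = w := by
      rw [mul_inv_rev, swap_inv, Perm.mul_apply, hu', swap_apply_left]
    have hne := hadj.ne
    rw [hw']
    rw [hu'] at ih
    have e : ∀ q, (ρ * swap u w) q = if q = u then ρ w else if q = w then x else ρ q := by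
      intro q
      simp only [Perm.mul_apply, swap_apply_def]
      split_ifs <;> simp_all
    simp only [e]
    by_cases hwD : w ∈ D
    · have hwv : w ≠ v := fun h => hv (h ▸ hwD)
      right
      refine ⟨hwD, fun q => ?_⟩
      rcases ih with ⟨huD, ih⟩ | ⟨huD, ih⟩
      · obtain rfl : u = v := by
          by_contra h
          exact huD (hD w hwD u hadj.symm h)
        have := ih q
        have := ih w
        split_ifs <;> grind
      · have := ih q
        have := ih w
        split_ifs <;> grind
    · left
      refine ⟨hwD, fun q => ?_⟩
      rcases ih with ⟨huD, ih⟩ | ⟨huD, ih⟩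
      · have := ih q
        have := ih w
        split_ifs <;> grind
      · obtain rfl : w = v := by
          by_contra h
          exact hwD (hD u huD w hadj h)
        have := ih q
        have := ih w
        split_ifs <;> grind

lemma Legal.eq_one (h : Legal G ∅ ρ) : ρ = 1 := by
  cases h with
  | one => rfl
  | step _ _ hb => exact hb.elim

lemma legal_ofSubtype_of_swap {B C : Set V} [DecidablePred (· ∈ C)] [Finite V]
    (hCB : ∀ u ∈ C, u ∉ B)
    (h : ∀ u ∈ C, ∀ v ∈ C, Legal G B (swap u v)) (π : Perm C) : Legal G B (Perm.ofSubtype π) := by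
  induction π using Perm.swap_induction_on with
  | one => simpa using Legal.one
  | swap_mul π x y _ ih =>
    rw [map_mul, Perm.ofSubtype_swap_eq]
    refine (h x x.2 y y.2).mul ?_
    convert ih using 1
    ext q
    have := hCB x x.2
    have := hCB y y.2
    simp only [Set.mem_ofPred_eq, swap_apply_def]
    split_ifs <;> simp_all

lemma Legal.ofSubtype {W A' : Set V} [DecidablePred (· ∈ W)] {A : Set W} {π : Perm W}
    (h : Legal (G.induce W) A π) (hA : ∀ a ∈ A, (a : V) ∈ A') : Legal G A' (Perm.ofSubtype π) := by
  induction h with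
  | one => simpa using Legal.one
  | @step π u v _ hadj hb ih =>
    rw [map_mul, Perm.ofSubtype_swap_eq]
    refine ih.step hadj ?_
    rw [Perm.ofSubtype_apply_coe]
    exact hA _ hb

end Topology

section Dichotomy

variable [Fintype V] {G : SimpleGraph V} {f : V → ℕ} {C K : Set V} {x : V}

/-- In a component spanned by a cycle, the tokens of a class only visit blank vertices
and vertices of the class. -/
lemma _root_.IsClass.mem_of_isCycle (hC : IsClass G f C)
    (hK : ∀ a b, G.Adj a b → (a ∈ K ↔ b ∈ K)) (hCK : C ⊆ K)
    {v₀ : V} {c : G.Walk v₀ v₀} (hc : c.IsCycle) (hcK : ∀ q ∈ K, q ∈ c.support)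
    {σ : Perm V} (hσ : Legal G {q | f q = 1} σ) {v : V} (hv : σ v ∈ C) (hvf : f v ≠ 1) :
    v ∈ C := by
  have hvK : v ∈ K := (mem_iff_of_reachable hK (hσ.reachable v)).1 (hCK hv)
  obtain ⟨τ, h1, h2, h3⟩ := hσ.restrict hK
  have h1' : Legal G {q | f q = 1} τ := h1.mono (restr_le _ _) Set.inter_subset_left
  have hτv : τ v ∈ C := by rwa [h2 v hvK]
  obtain ⟨π, g1, g2, g3⟩ := exists_legal_regather (G := G) (D := K \ {v})
    (fun a ha b hb => .of_isCycle hc hK hcK hvK ha hb)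
    (Finset.univ.filter fun q => f (τ q) = 1) (Finset.univ.filter fun q => f q = 1)
    (Finset.card_bij (fun q _ => τ q) (by simp) (by simp) fun b hb => ⟨τ⁻¹ b, by simpa using hb⟩)
    (fun q hq => by
      simp only [Finset.mem_filter, Finset.mem_univ, true_and]
      by_cases hqv : q = v
      · subst hqv; simp [hC.ne_one hτv, hvf]
      · rw [h3 q fun h => hq ⟨h, hqv⟩])
  simp only [Finset.coe_filter, Finset.mem_filter, Finset.mem_univ, true_and] at g1 g3
  refine (hC.mem_iff (h1'.mul g1) g3 v).1 ?_
  rwa [Perm.mul_apply, g2 v fun h => h.2 rfl]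

/-- With a single blank `x` in the component, the tokens of a class `C` which can visit a token `v`
outside of the class are attached to the rest of the graph at `v` only. -/
lemma _root_.IsClass.conn_of_single (hC : IsClass G f C)
    (hK : ∀ a b, G.Adj a b → (a ∈ K ↔ b ∈ K)) (hCK : C ⊆ K)
    (hxK' : x ∈ K) (hxK : ∀ q ∈ K, f q = 1 ↔ q = x)
    {u₀ : V} (hu₀ : u₀ ∈ C)
    {v : V} (hv : v ∈ RC G f C) (hvC : v ∉ C) (hvf : f v ≠ 1) :
    ¬ Conn G {v}ᶜ u₀ x ∧ (∀ q ∈ C, Conn G {v}ᶜ u₀ q) ∧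
      ∀ q ∈ RC G f C, q ≠ v → Conn G {v}ᶜ u₀ q := by
  have hrestr : ∀ {σ : Perm V}, Legal G {q | f q = 1} σ → ∃ τ, Legal G {q | f q = 1} τ ∧
      Legal G {x} τ ∧ (∀ q ∈ K, τ q = σ q) ∧ ∀ q ∉ K, τ q = q := by
    intro σ hσ
    obtain ⟨τ, h1, h2, h3⟩ := hσ.restrict hK
    exact ⟨τ, h1.mono (restr_le _ _) Set.inter_subset_left,
      h1.mono (restr_le _ _) fun q hq => (hxK q hq.2).1 hq.1, h2, h3⟩
  obtain ⟨σ₀, hσ₀, hv₀⟩ := hC.mem_RC_iff.1 hv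
  have hvK : v ∈ K := (mem_iff_of_reachable hK (hσ₀.reachable v)).1 (hCK hv₀)
  obtain ⟨σ, hσ, hσx, hσe, hσK⟩ := hrestr hσ₀
  have hσv : σ v ∈ C := by rwa [hσe v hvK]
  obtain ⟨z, hσz⟩ := σ.surjective x
  have hmemK : ∀ q, σ q ∈ K ↔ q ∈ K := fun q => mem_iff_of_reachable hK (hσ.reachable q)
  have hblank : ∀ q, f (σ q) = 1 ↔ q = z ∧ q ∈ K ∨ q ∉ K ∧ f q = 1 := by
    intro q
    by_cases hq : q ∈ K
    · rw [hxK _ ((hmemK q).2 hq), ← hσz, σ.injective.eq_iff]; simp [hq]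
    · rw [hσK q hq]; simp [hq]
  have hzK : z ∈ K := (hmemK z).1 (hσz ▸ hxK')
  have hfx : f x = 1 := (hxK x hxK').2 rfl
  have hxv : x ≠ v := by rintro rfl; exact hvf hfx
  have hzv : z ≠ v := by
    intro h
    rw [← h, hσz] at hσv
    exact hC.ne_one hσv hfx
  have hnot : ¬ Conn G {v}ᶜ z x := by
    intro hconn
    obtain ⟨τ, h1, h2, h3⟩ := exists_legal_of_conn hconn {q | f (σ q) = 1}
    refine hvC ((hC.mem_iff (hσ.mul (h1.mono (restr_le _ _) subset_rfl)) (fun q => ?_) v).1 ?_)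
    · rw [Perm.mul_apply]
      refine (h3 q).trans ?_
      rw [Set.mem_ofPred_eq, hblank, swap_apply_def]
      by_cases hq : q ∈ K
      · rw [hxK q hq]
        split_ifs <;> grind
      · have hqz : q ≠ z := by rintro rfl; exact hq hzK
        have hqx : q ≠ x := by rintro rfl; exact hq hxK'
        simp [if_neg hqx, hqz, hq]
    · rwa [Perm.mul_apply, h2 v (by simp)]
  set D : Set V := {q | Conn G {v}ᶜ z q} with hD
  have hzD : z ∈ D := .refl hzv
  have hvD : v ∉ D := fun h => h.right_mem rfl
  have hatt : ∀ a ∈ D, ∀ b, G.Adj a b → b ≠ v → b ∈ D := fun a ha b hab hb =>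
    Conn.trans ha (.of_adj hab (Conn.right_mem ha) hb)
  have hinv : ∀ {ρ : Perm V}, Legal G {x} ρ → _ := fun hρ => hρ.mem_iff_of_attached hvD hnot hatt
  have huD : σ v ∈ D := by
    have hz : σ⁻¹ x = z := by rw [← hσz]; simp
    rw [← hz] at hzD hzv
    rcases hinv hσx with ⟨h, -⟩ | ⟨-, h⟩
    · exact absurd hzD h
    · exact (h v).2 ⟨.inr rfl, hzv.symm⟩
  have hCD : C ⊆ D := by
    intro w hw
    obtain ⟨ρ, hρ, hρw, hρb⟩ := hC.exists_legal hσv hw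
    obtain ⟨τ, h1, h2, h3, h4⟩ := hrestr hρ
    have hτx : τ⁻¹ x = x := by
      have hm : τ⁻¹ x ∈ K := by
        have := h1.reachable (τ⁻¹ x)
        rw [show τ (τ⁻¹ x) = x by simp] at this
        exact (mem_iff_of_reachable hK this).1 hxK'
      refine (hxK _ hm).1 ((hρb _).1 ?_)
      rw [← h3 _ hm]
      simpa
    rcases hinv h2 with ⟨-, h⟩ | ⟨h, -⟩
    · exact (h w).1 (by rwa [h3 w (hCK hw), hρw])
    · exact absurd (hτx ▸ h) hnot
  have hRD : ∀ q ∈ RC G f C, q ≠ v → q ∈ D := by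
    intro q hq hqv
    obtain ⟨ρ, hρ, hρq⟩ := hC.mem_RC_iff.1 hq
    have hqK : q ∈ K := (mem_iff_of_reachable hK (hρ.reachable q)).1 (hCK hρq)
    obtain ⟨τ, h1, h2, h3, h4⟩ := hrestr hρ
    have hτq : τ q ∈ D := hCD (by rwa [h3 q hqK])
    rcases hinv h2 with ⟨-, h⟩ | ⟨-, h⟩
    · exact (h q).1 hτq
    · exact ((h q).1 hτq).1.resolve_right hqv
  have hzu : Conn G {v}ᶜ z u₀ := hCD hu₀
  exact ⟨fun h => hnot (hzu.trans h), fun q hq => hzu.symm.trans (hCD hq),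
    fun q hq hqv => hzu.symm.trans (hRD q hq hqv)⟩

/-- The three ways in which the solution of a sub-instance can be lifted to the whole graph. -/
lemma _root_.IsClass.trichotomy (hC : IsClass G f C) :
    (∀ q ∈ RC G f C, q ∉ C → f q = 1) ∨
    (∃ v τ, Legal G {q | f q = 1} τ ∧ (∀ q ∈ C, τ q = q) ∧ (∀ q ∈ RC G f C, q ∉ C → q = v) ∧
      f (τ v) = 1) ∨
    ∀ u ∈ C, ∀ v ∈ C, Legal G {q | f q = 1} (swap u v) := by
  obtain ⟨u₀, hu₀⟩ : ∃ u₀, u₀ ∈ C := by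
    obtain ⟨u₀, h, rfl⟩ := hC
    exact ⟨u₀, h, (sim_iff h).2 ⟨1, .one, rfl, fun _ => Iff.rfl⟩⟩
  set K : Set V := {q | G.Reachable u₀ q}
  have hK : ∀ a b, G.Adj a b → (a ∈ K ↔ b ∈ K) := fun a b hab =>
    ⟨fun h => h.trans hab.reachable, fun h => h.trans hab.symm.reachable⟩
  have hK' : ∀ a ∈ K, ∀ b ∈ K, G.Reachable a b := fun a ha b hb => ha.symm.trans hb
  have hCK : C ⊆ K := fun q hq => by
    obtain ⟨σ, h1, h2, -⟩ := hC.exists_legal hu₀ hq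
    change G.Reachable u₀ q
    rw [← h2]
    exact h1.reachable q
  by_cases hcyc : ∀ v ∈ K, ∀ c : G.Walk v v, c.IsCycle → ∃ o ∈ K, o ∉ c.support
  · by_cases hb : ∃ x ∈ K, ∃ y ∈ K, x ∈ {q | f q = 1} ∧ y ∈ {q | f q = 1} ∧ x ≠ y
    · refine .inr (.inr fun u hu v hv => ?_)
      obtain ⟨σ, h1, h2, h3⟩ := hC.exists_legal hu hv
      rw [← h2]
      exact h1.swap_apply_self hK hK' hb hcyc h3 (hCK hv) (hC.ne_one hv)
    · by_cases hA : ∀ q ∈ RC G f C, q ∉ C → f q = 1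
      · exact .inl hA
      push Not at hA
      obtain ⟨v, hv, hvC, hvf⟩ := hA
      obtain ⟨x, hx, hfx⟩ : ∃ x ∈ K, f x = 1 := by
        by_contra! h
        obtain ⟨σ, hσ, hσv⟩ := hC.mem_RC_iff.1 hv
        have hvK : v ∈ K := (mem_iff_of_reachable hK (hσ.reachable v)).1 (hCK hσv)
        obtain ⟨τ, h1, h2, -⟩ := hσ.restrict hK
        have hτ : τ = 1 := (h1.mono le_rfl fun q hq => h q hq.2 hq.1).eq_one
        rw [← h2 v hvK, hτ] at hσv
        exact hvC hσv
      have hxK : ∀ q ∈ K, f q = 1 ↔ q = x := fun q hq => by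
        refine ⟨fun h => ?_, fun h => h ▸ hfx⟩
        by_contra hne
        exact hb ⟨q, hq, x, hx, h, hfx, hne⟩
      obtain ⟨hnc, hCc, hRc⟩ := hC.conn_of_single hK hCK hx hxK hu₀ hv hvC hvf
      have hRK : ∀ q ∈ RC G f C, q ∈ K := fun q hq => by
        obtain ⟨σ, hσ, hq⟩ := hC.mem_RC_iff.1 hq
        exact (hCK hq).trans (hσ.reachable q)
      obtain ⟨p, hp⟩ := (hK' x hx v (hRK v hv)).exists_isPath
      have hpre : ∀ q ∈ p.support, q ≠ v → Conn G {v}ᶜ q x := fun q hq hqv =>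
        Conn.symm ⟨p.takeUntil q hq, fun y hy => by
          rintro rfl
          exact Walk.endpoint_notMem_support_takeUntil hp hq hqv.symm hy⟩
      have huniq : ∀ q ∈ RC G f C, q ∉ C → q = v := by
        intro v' hv' hvC'
        by_contra hne
        have hvc' := hRc v' hv' hne
        have hvf' : f v' ≠ 1 := fun h => hnc ((hxK v' (hRK v' hv')).1 h ▸ hvc')
        obtain ⟨hnc', -, hRc'⟩ := hC.conn_of_single hK hCK hx hxK hu₀ hv' hvC' hvf'
        by_cases hvp : v' ∈ p.support
        · exact hnc (hvc'.trans (hpre v' hvp hne))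
        · exact hnc' ((hRc' v hv (Ne.symm hne)).trans
            (Conn.symm ⟨p, fun y hy => by rintro rfl; exact hvp hy⟩))
      obtain ⟨τ, h1, h2, h3⟩ := exists_legal_of_conn (G := G) (D := Cᶜ) (x := x) (y := v)
        ⟨p, fun q hq hqC => by
          have hqv : q ≠ v := by rintro rfl; exact hvC hqC
          exact hnc ((hCc q hqC).trans (hpre q hq hqv))⟩ {q | f q = 1}
      exact .inr (.inl ⟨v, τ, h1.mono (restr_le _ _) subset_rfl, fun q hq => h2 q fun h => h hq,
        huniq, (h3 v).2 (by simpa using hfx)⟩)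
  · push Not at hcyc
    obtain ⟨v₀, -, c, hc, hcK⟩ := hcyc
    refine .inl fun q hq hqC => ?_
    obtain ⟨σ, hσ, hσq⟩ := hC.mem_RC_iff.1 hq
    by_contra hqf
    exact hqC (hC.mem_of_isCycle hK hCK hc hcK hσ hσq hqf)

end Dichotomy

section Assembly

variable [Fintype V] {G : SimpleGraph V} {f g : V → ℕ} {C : Set V}

omit [DecidableEq V] [Fintype V] in
open scoped Classical in
lemma subConfig_eq_one_iff {W : Set V} (hg : ∀ q ∈ C, g q ≠ 1) (x : W) :
    subConfig g C W x = 1 ↔ (x : V) ∉ C := by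
  unfold subConfig
  split_ifs with h
  · simp [h, hg _ h]
  · simp [h]

omit [Fintype V] in
open scoped Classical in
/-- The permutation underlying a solution of a sub-instance. -/
lemma _root_.IsClass.exists_perm (hC : IsClass G f C) (hB : ∀ q, f q = 1 ↔ g q = 1)
    (h : ReachableConf (G.induce (C ∪ RC G f C)) StarSwap
      (subConfig f C (C ∪ RC G f C)) (subConfig g C (C ∪ RC G f C))) :
    ∃ π : Perm V, (∀ q, π q ∈ C ↔ q ∈ C) ∧ (∀ q ∈ C, f (π q) = g q) ∧
      (∀ q ∈ RC G f C, q ∉ C → π q ∈ RC G f C) ∧ (∀ q ∉ RC G f C, q ∉ C → π q = q) ∧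
      ∀ A : Set V, (∀ q ∈ RC G f C, q ∉ C → q ∈ A) → Legal G A π := by
  obtain ⟨ρ, hρ, hgρ⟩ := reachableConf_iff.1 h
  have hfC : ∀ q ∈ C, f q ≠ 1 := fun q hq => hC.ne_one hq
  have hgC : ∀ q ∈ C, g q ≠ 1 := fun q hq h => hfC q hq ((hB q).2 h)
  have hρC : ∀ x, (ρ x : V) ∈ C ↔ (x : V) ∈ C := fun x => by
    have := congrFun hgρ x
    rw [← not_iff_not, ← subConfig_eq_one_iff hfC, ← subConfig_eq_one_iff hgC, this]
    rfl
  have hπ : ∀ q (hq : q ∈ C ∪ RC G f C), Perm.ofSubtype ρ q = ρ ⟨q, hq⟩ := fun q hq =>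
    Perm.ofSubtype_apply_of_mem ρ hq
  have hπC : ∀ q, Perm.ofSubtype ρ q ∈ C ↔ q ∈ C := fun q => by
    by_cases hq : q ∈ C ∪ RC G f C
    · rw [hπ q hq, hρC]
    · rw [Perm.ofSubtype_apply_of_not_mem ρ hq]
  refine ⟨Perm.ofSubtype ρ, hπC, fun q hq => ?_, fun q hq hqC => ?_, fun q hq hqC => ?_,
    fun A hA => hρ.ofSubtype fun x hx => ?_⟩
  · rw [hπ q (.inl hq)]
    have := congrFun hgρ ⟨q, .inl hq⟩
    simp only [subConfig, Function.comp_apply, hρC, hq, if_true] at this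
    exact this.symm
  · have := (hπC q).not.2 hqC
    rw [hπ q (.inr hq)] at this ⊢
    exact (ρ ⟨q, .inr hq⟩).2.resolve_left this
  · exact Perm.ofSubtype_apply_of_not_mem ρ fun h => h.elim hqC hq
  · have hxC := (subConfig_eq_one_iff hfC x).1 hx
    exact hA x (x.2.resolve_left hxC) hxC

/-- A solution of a sub-instance can be lifted to the whole graph. -/
lemma _root_.IsClass.lift (hC : IsClass G f C) (hB : ∀ q, f q = 1 ↔ g q = 1)
    (h : ReachableConf (G.induce (C ∪ RC G f C)) StarSwap
      (subConfig f C (C ∪ RC G f C)) (subConfig g C (C ∪ RC G f C))) :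
    ∃ σ, Legal G {q | f q = 1} σ ∧ (∀ q ∈ C, f (σ q) = g q) ∧ ∀ q ∉ C, f (σ q) = f q := by
  classical
  obtain ⟨π, h1, h2, h3, h4, h5⟩ := hC.exists_perm hB h
  rcases hC.trichotomy with hA | ⟨v, τ, hτ, hτC, huniq, hτv⟩ | hS
  · refine ⟨π, h5 _ hA, h2, fun q hq => ?_⟩
    by_cases hqR : q ∈ RC G f C
    · rw [hA q hqR hq, hA _ (h3 q hqR hq) ((h1 q).not.2 hq)]
    · rw [h4 q hqR hq]
  · have hπ : ∀ q ∉ C, π q = q := fun q hq => by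
      by_cases hqR : q ∈ RC G f C
      · exact (huniq _ (h3 q hqR hq) ((h1 q).not.2 hq)).trans (huniq q hqR hq).symm
      · exact h4 q hqR hq
    have hτC' : ∀ q, τ q ∈ C ↔ q ∈ C := fun q =>
      ⟨fun hq => by rwa [← τ.injective (hτC _ hq)], fun hq => by rwa [hτC q hq]⟩
    have hτi : ∀ q, τ⁻¹ q ∈ C ↔ q ∈ C := fun q => by
      rw [← hτC', Perm.eq_inv_iff_eq.1 rfl]
    refine ⟨τ * (π * τ⁻¹), hτ.mul ((h5 _ fun q hq hqC => ?_).mul (hτ.inv.mono le_rfl ?_)),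
      fun q hq => ?_, fun q hq => ?_⟩
    · rw [huniq q hq hqC]
      exact hτv
    · intro q hq
      have hqC : q ∉ C := fun h => hC.ne_one h (by rw [← hτC q h]; exact hq)
      change f (τ (π q)) = 1
      rwa [hπ q hqC]
    · have hqi : τ⁻¹ q = q := by rw [Perm.inv_eq_iff_eq, hτC q hq]
      rw [Perm.mul_apply, Perm.mul_apply, hqi, hτC _ ((h1 q).2 hq), h2 q hq]
    · rw [Perm.mul_apply, Perm.mul_apply, hπ _ ((hτi q).not.2 hq), Perm.eq_inv_iff_eq.1 rfl]
  · refine ⟨Perm.ofSubtype (π.subtypePerm (p := (· ∈ C)) h1),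
      legal_ofSubtype_of_swap (fun u hu => hC.ne_one hu) hS _, fun q hq => ?_, fun q hq => ?_⟩
    · rw [Perm.ofSubtype_apply_of_mem _ hq]
      exact h2 q hq
    · rw [Perm.ofSubtype_apply_of_not_mem _ hq]

/-- Solutions of the sub-instances combine to a solution of the instance. -/
lemma reachableConf_of_forall_isClass (hB : ∀ q, f q = 1 ↔ g q = 1)
    (hf : ∀ u v, f u = f v → f u ≠ 1 → u = v)
    (h : ∀ C, IsClass G f C → ReachableConf (G.induce (C ∪ RC G f C)) StarSwap
      (subConfig f C (C ∪ RC G f C)) (subConfig g C (C ∪ RC G f C))) :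
    ReachableConf G StarSwap f g := by
  classical
  have key : ∀ S : Finset (Set V), (∀ C ∈ S, IsClass G f C) → ∃ σ, Legal G {q | f q = 1} σ ∧
      (∀ C ∈ S, ∀ q ∈ C, f (σ q) = g q) ∧ ∀ q, (∀ C ∈ S, q ∉ C) → f (σ q) = f q := by
    intro S
    induction S using Finset.induction_on with
    | empty => exact fun _ => ⟨1, .one, by simp, by simp⟩
    | insert C S hCS ih =>
      intro hS
      obtain ⟨σ, h1, h2, h3⟩ := ih fun D hD => hS D (Finset.mem_insert_of_mem hD)
      have hC := hS C (Finset.mem_insert_self C S)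
      obtain ⟨ρ, g1, g2, g3⟩ := hC.lift hB (h C hC)
      have hdisj : ∀ q ∈ C, ∀ D ∈ S, q ∉ D := fun q hq D hD hqD =>
        hCS (hC.eq_of_mem (hS D (Finset.mem_insert_of_mem hD)) hq hqD ▸ hD)
      have hσB : ∀ q, f (σ q) = 1 ↔ f q = 1 := fun q => by
        by_cases hq : ∃ D ∈ S, q ∈ D
        · obtain ⟨D, hD, hq⟩ := hq
          rw [h2 D hD q hq, hB]
        · push Not at hq
          rw [h3 q hq]
      have hρB : ∀ q, f (ρ q) = 1 ↔ f q = 1 := fun q => by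
        by_cases hq : q ∈ C
        · rw [g2 q hq, hB]
        · rw [g3 q hq]
      have hρ : ∀ q ∉ C, f q ≠ 1 → ρ q = q := fun q hq hqf =>
        hf _ _ (g3 q hq) ((hρB q).not.2 hqf)
      refine ⟨σ * ρ, h1.mul (g1.mono le_rfl fun q hq => (hσB q).2 hq), fun D hD q hq => ?_,
        fun q hq => ?_⟩
      · rw [Perm.mul_apply]
        rcases Finset.mem_insert.1 hD with rfl | hD'
        · rw [h3 _ (hdisj _ ((hC.mem_iff g1 hρB q).2 hq)), g2 q hq]
        · rw [hρ q (fun h => hdisj q h D hD' hq) ((hS D hD).ne_one hq), h2 D hD' q hq]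
      · rw [Perm.mul_apply]
        by_cases hqf : f q = 1
        · rw [hqf, hσB, hρB, hqf]
        · rw [hρ q (hq C (Finset.mem_insert_self C S)) hqf,
            h3 q fun D hD => hq D (Finset.mem_insert_of_mem hD)]
  obtain ⟨σ, h1, h2, h3⟩ := key (Finset.univ.filter fun C => IsClass G f C) (by simp)
  refine reachableConf_iff.2 ⟨σ, h1, funext fun q => ?_⟩
  by_cases hq : f q = 1
  · rw [Function.comp_apply, h3 q, hq, (hB q).1 hq]
    exact fun C hC hqC => (Finset.mem_filter.1 hC).2.ne_one hqC hq
  · obtain ⟨C, hC, hqC⟩ := IsClass.exists_mem (G := G) hq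
    exact (h2 C (by simpa) q hqC).symm

/-- A solution of the instance restricts to a solution of each sub-instance. -/
lemma _root_.IsClass.reachableConf_subConfig (hC : IsClass G f C) (hB : ∀ q, f q = 1 ↔ g q = 1)
    (h : ReachableConf G StarSwap f g) :
    ReachableConf (G.induce (C ∪ RC G f C)) StarSwap
      (subConfig f C (C ∪ RC G f C)) (subConfig g C (C ∪ RC G f C)) := by
  obtain ⟨σ, hσ, rfl⟩ := reachableConf_iff.1 h
  have hσC := hC.mem_iff hσ fun q => (hB q).symm
  convert reachableConf_induce hC hσ using 2 with x
  by_cases hx : (x : V) ∈ C <;> simp [subConfig, hσC, hx]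

end Assembly

end TokenSwap

/-- For an instance with the star swap graph, `B(f) = B(g)`, and all tokens of color
other than `1` having pairwise distinct colors (each color `≠ 1` is held by exactly one
vertex in `f` and by exactly one vertex in `g`), the instance is solvable iff every
sub-instance `I_C` associated with an equivalence class `C` of `~` is solvable. -/
theorem solvable_iff_subinstances_solvable_distinct {V : Type*} [DecidableEq V]
    [Fintype V] (G : SimpleGraph V) (f g : V → ℕ)
    (hB : {v | f v = 1} = {v | g v = 1})
    (hf : ∀ u v : V, f u = f v → f u ≠ 1 → u = v)
    (hg : ∀ u v : V, g u = g v → g u ≠ 1 → u = v) :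
    ReachableConf G StarSwap f g ↔
      ∀ C : Set V, IsClass G f C →
        ReachableConf (G.induce (C ∪ RC G f C)) StarSwap
          (subConfig f C (C ∪ RC G f C)) (subConfig g C (C ∪ RC G f C)) := by
  have hB' : ∀ q, f q = 1 ↔ g q = 1 := Set.ext_iff.1 hB
  exact ⟨fun h C hC => hC.reachableConf_subConfig hB' h,
    TokenSwap.reachableConf_of_forall_isClass hB' hf⟩
end

section
/- Let the base graph G be the cycle on n ≥ 3 vertices v_0, v_1, …, v_{n−1} (in cyclic order, v_i adjacent to v_{i+1 mod n}), with the star swap graph centered at color 1, and let f be a configuration with at least one blank vertex. For a configuration h, let L(h) be the list of colors h(v_0), h(v_1), …, h(v_{n−1}) with all occurrences of the color 1 removed. Then a configuration g is reachable from f if and only if L(g) is a cyclic rotation of L(f) and g has the same number of blank vertices as f. -/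
/-- The list of colors of a configuration on the cycle, read in cyclic vertex order,
with all occurrences of the blank color `1` removed. -/
def nonBlankList {n : ℕ} (h : Fin n → ℕ) : List ℕ :=
  (List.ofFn h).filter (· ≠ 1)

theorem StarSwap.symm {c d : ℕ} (h : StarSwap c d) : StarSwap d c :=
  ⟨h.1.symm, h.2.symm⟩

/-- The swaps of the star swap graph on a cycle, in terms of the list of colors around it. -/
inductive CyclicListStep : List ℕ → List ℕ → Prop
  | mid (a b : List ℕ) (x y : ℕ) (h : StarSwap x y) :
      CyclicListStep (a ++ x :: y :: b) (a ++ y :: x :: b)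
  | wrap (m : List ℕ) (x y : ℕ) (h : StarSwap x y) :
      CyclicListStep (x :: (m ++ [y])) (y :: (m ++ [x]))

theorem CyclicListStep.symm {l l' : List ℕ} (h : CyclicListStep l l') : CyclicListStep l' l := by
  cases h with
  | mid a b x y h => exact .mid a b y x h.symm
  | wrap m x y h => exact .wrap m y x h.symm

theorem CyclicListStep.filter_isRotated {l l' : List ℕ} (h : CyclicListStep l l') :
    l.filter (· ≠ 1) ~r l'.filter (· ≠ 1) := by
  cases h with
  | mid a b x y h =>
    obtain ⟨hne, rfl | rfl⟩ := h <;> simp [List.filter_cons, List.IsRotated.refl]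
  | wrap m x y h =>
    obtain ⟨hne, rfl | rfl⟩ := h
    · simpa [List.filter_cons, hne.symm] using List.isRotated_concat y (m.filter (· ≠ 1))
    · simpa [List.filter_cons, hne] using (List.isRotated_concat x (m.filter (· ≠ 1))).symm

theorem CyclicListStep.reflTransGen_symm {l l' : List ℕ}
    (h : Relation.ReflTransGen CyclicListStep l l') :
    Relation.ReflTransGen CyclicListStep l' l :=
  haveI : Std.Symm CyclicListStep := ⟨fun _ _ h => h.symm⟩
  Relation.ReflTransGen.stdSymm.symm _ _ h

/-- Pushing a blank to the right through a list of nonblank colors. -/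
theorem CyclicListStep.push_blank (a l b : List ℕ) (hl : ∀ x ∈ l, x ≠ 1) :
    Relation.ReflTransGen CyclicListStep (a ++ 1 :: (l ++ b)) (a ++ (l ++ 1 :: b)) := by
  induction l generalizing a with
  | nil => exact .refl
  | cons x l ih =>
    refine .head (.mid a (l ++ b) 1 x ⟨(hl x (by simp)).symm, .inl rfl⟩) ?_
    simpa using ih (a ++ [x]) fun y hy => hl y (by simp [hy])

/-- All blanks can be moved to the end of the list. -/
theorem CyclicListStep.gather_blanks (a l : List ℕ) :
    Relation.ReflTransGen CyclicListStep (a ++ l)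
      (a ++ (l.filter (· ≠ 1) ++ List.replicate (l.count 1) 1)) := by
  induction l generalizing a with
  | nil => exact .refl
  | cons x l ih =>
    have h := ih (a ++ [x])
    by_cases hx : x = 1
    · subst hx
      refine .trans (by simpa using h) ?_
      simpa [List.replicate_succ] using
        push_blank a (l.filter (· ≠ 1)) (List.replicate (l.count 1) 1) (by simp)
    · simpa [hx, List.filter_cons] using h

theorem CyclicListStep.rotate_one (l : List ℕ) (hl : ∀ x ∈ l, x ≠ 1) (k : ℕ) :
    Relation.ReflTransGen CyclicListStep (l ++ List.replicate (k + 1) 1)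
      (l.rotate 1 ++ List.replicate (k + 1) 1) := by
  cases l with
  | nil => exact .refl
  | cons x l =>
    have hx : x ≠ 1 := hl x (by simp)
    have hl' : ∀ y ∈ l, y ≠ 1 := fun y hy => hl y (by simp [hy])
    have hf : l.filter (· ≠ 1) = l := by simpa using hl'
    have hc : l.count 1 = 0 := List.count_eq_zero.2 fun h => hl' 1 h rfl
    have h1 := CyclicListStep.wrap (l ++ List.replicate k 1) x 1 ⟨hx, .inr rfl⟩
    have h2 := gather_blanks [] (1 :: (l ++ List.replicate k 1 ++ [x]))
    have e1 : (1 :: (l ++ List.replicate k 1 ++ [x])).filter (· ≠ 1) = l ++ [x] := by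
      simp only [ne_eq, decide_not] at hf
      simp [hx, hf]
    have e2 : (1 :: (l ++ List.replicate k 1 ++ [x])).count 1 = k + 1 := by
      simp [List.count_append, hx, hc]
    rw [e1, e2] at h2
    refine .head (b := 1 :: (l ++ List.replicate k 1 ++ [x])) ?_ (by simpa using h2)
    rw [List.replicate_succ']
    simpa using h1

theorem CyclicListStep.rotate (l : List ℕ) (hl : ∀ x ∈ l, x ≠ 1) (k m : ℕ) :
    Relation.ReflTransGen CyclicListStep (l ++ List.replicate (k + 1) 1)
      (l.rotate m ++ List.replicate (k + 1) 1) := by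
  induction m with
  | zero => simpa using .refl
  | succ m ih =>
    rw [← List.rotate_rotate]
    exact ih.trans (rotate_one _ (by simpa using hl) k)

/-- Lists with a blank, equally many blanks, and rotated nonblank parts reach each other. -/
theorem CyclicListStep.reflTransGen_of_isRotated {l l' : List ℕ} (h1 : 1 ∈ l)
    (hr : l.filter (· ≠ 1) ~r l'.filter (· ≠ 1)) (hc : l.count 1 = l'.count 1) :
    Relation.ReflTransGen CyclicListStep l l' := by
  obtain ⟨m, hm⟩ := hr
  obtain ⟨k, hk⟩ := Nat.exists_eq_succ_of_ne_zero (List.count_pos_iff.2 h1).ne'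
  have hl := gather_blanks [] l
  have hl' := gather_blanks [] l'
  have hrot := rotate (l.filter (· ≠ 1)) (by simp) k m
  rw [← hm, ← hc, hk] at hl'
  rw [hk] at hl
  exact (hl.trans hrot).trans (reflTransGen_symm hl')

theorem List.ofFn_update {α : Type*} {n : ℕ} (f : Fin n → α) (i : Fin n) (x : α) :
    List.ofFn (Function.update f i x) = (List.ofFn f).set i x := by
  apply List.ext_getElem
  · simp
  · intro j h _
    simp only [List.getElem_ofFn, List.getElem_set, Function.update_apply, Fin.ext_iff, eq_comm]

/-- Consecutive vertices of a cycle, up to order: the smaller one first. -/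
theorem SimpleGraph.cycleGraph_adj_iff_val {n : ℕ} (hn : 3 ≤ n) {u v : Fin n} :
    (SimpleGraph.cycleGraph n).Adj u v ↔
      ((v.val = u.val + 1 ∨ u.val = 0 ∧ v.val + 1 = n) ∨
        (u.val = v.val + 1 ∨ v.val = 0 ∧ u.val + 1 = n)) := by
  rw [SimpleGraph.cycleGraph_adj']
  have hu := u.isLt
  have hv := v.isLt
  rcases lt_trichotomy u v with h | h | h
  · rw [Fin.coe_sub_iff_lt.2 h, Fin.coe_sub_iff_le.2 h.le]
    have := Fin.lt_def.1 h
    omega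
  · subst h
    rw [Fin.coe_sub_iff_le.2 le_rfl]
    omega
  · rw [Fin.coe_sub_iff_lt.2 h, Fin.coe_sub_iff_le.2 h.le]
    have := Fin.lt_def.1 h
    omega

theorem CyclicListStep.of_ordered {n : ℕ} (f : Fin n → ℕ) {u v : Fin n}
    (huv : v.val = u.val + 1 ∨ u.val = 0 ∧ v.val + 1 = n) (hne : u ≠ v)
    (hs : StarSwap (f u) (f v)) :
    CyclicListStep (List.ofFn f)
      (List.ofFn (Function.update (Function.update f u (f v)) v (f u))) := by
  have hu := u.isLt
  have hv := v.isLt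
  rw [List.ofFn_update, List.ofFn_update]
  have hfu : (List.ofFn f)[u.val]? = some (f u) := by simp
  have hfv : (List.ofFn f)[v.val]? = some (f v) := by simp
  have hlen : (List.ofFn f).length = n := by simp
  generalize List.ofFn f = l at *
  rcases huv with huv | ⟨h0, h1⟩
  · have key : ∃ a x y b, l = a ++ x :: y :: b ∧ a.length = u.val :=
      ⟨l.take u, l[u], l[u.val + 1], l.drop (u.val + 2), by simp, by simp; omega⟩
    obtain ⟨a, x, y, b, rfl, ha⟩ := key
    have hx : x = f u := by simpa [← ha] using hfu
    have hy : y = f v := by simpa [huv, ← ha] using hfv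
    simpa [huv, ← ha, hx, hy] using CyclicListStep.mid a b _ _ hs
  · have key : ∃ x m y, l = x :: (m ++ [y]) := by
      cases l with
      | nil => simp at hfu
      | cons x l =>
        have hl : l ≠ [] := by
          rintro rfl
          exact hne (Fin.ext (by simp at hlen; omega))
        exact ⟨x, l.dropLast, l.getLast hl, by rw [List.dropLast_append_getLast hl]⟩
    obtain ⟨x, m, y, rfl⟩ := key
    have hv' : v.val = m.length + 1 := by simp at hlen; omega
    have hx : x = f u := by simpa [h0] using hfu
    have hy : y = f v := by simpa [hv'] using hfv
    simpa [h0, hv', hx, hy] using CyclicListStep.wrap m _ _ hs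

theorem SwapStep.cyclicListStep {n : ℕ} (hn : 3 ≤ n) {f g : Fin n → ℕ}
    (h : SwapStep (SimpleGraph.cycleGraph n) StarSwap f g) :
    CyclicListStep (List.ofFn f) (List.ofFn g) := by
  obtain ⟨u, v, huv, hs, rfl⟩ := h
  have hne := huv.ne
  rcases (SimpleGraph.cycleGraph_adj_iff_val hn).1 huv with h | h
  · exact .of_ordered f h hne hs
  · rw [Function.update_comm hne]
    exact .of_ordered f h hne.symm hs.symm

theorem CyclicListStep.exists_swapStep {n : ℕ} (hn : 3 ≤ n) {f : Fin n → ℕ} {l : List ℕ}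
    (h : CyclicListStep (List.ofFn f) l) :
    ∃ g, List.ofFn g = l ∧ SwapStep (SimpleGraph.cycleGraph n) StarSwap f g := by
  have hlen : (List.ofFn f).length = n := by simp
  have hget : ∀ i : Fin n, (List.ofFn f)[i.val]? = some (f i) := by simp
  generalize hl : List.ofFn f = l₀ at *
  cases h with
  | mid a b x y h =>
    have hlen' : a.length + (b.length + 1 + 1) = n := by simpa using hlen
    let u : Fin n := ⟨a.length, by omega⟩
    let v : Fin n := ⟨a.length + 1, by omega⟩
    have hu : f u = x := Eq.symm (by simpa [u] using hget u)
    have hv : f v = y := Eq.symm (by simpa [v] using hget v)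
    refine ⟨_, ?_, u, v, (SimpleGraph.cycleGraph_adj_iff_val hn).2 (by simp [u, v]),
      by rwa [hu, hv], rfl⟩
    rw [List.ofFn_update, List.ofFn_update, hl, hu, hv]
    simp [u, v]
  | wrap m x y h =>
    have hlen' : m.length + 1 + 1 = n := by simpa using hlen
    let u : Fin n := ⟨0, by omega⟩
    let v : Fin n := ⟨m.length + 1, by omega⟩
    have hu : f u = x := Eq.symm (by simpa [u] using hget u)
    have hv : f v = y := Eq.symm (by simpa [v] using hget v)
    refine ⟨_, ?_, u, v, (SimpleGraph.cycleGraph_adj_iff_val hn).2 (by simp [u, v, hlen']),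
      by rwa [hu, hv], rfl⟩
    rw [List.ofFn_update, List.ofFn_update, hl, hu, hv]
    simp [u, v]

theorem reachableConf_cycleGraph_iff {n : ℕ} (hn : 3 ≤ n) {f g : Fin n → ℕ} :
    ReachableConf (SimpleGraph.cycleGraph n) StarSwap f g ↔
      Relation.ReflTransGen CyclicListStep (List.ofFn f) (List.ofFn g) := by
  constructor
  · intro h
    exact Relation.ReflTransGen.lift List.ofFn (fun _ _ h => SwapStep.cyclicListStep hn h) _ _ h
  · intro h
    have key : ∀ l, Relation.ReflTransGen CyclicListStep (List.ofFn f) l →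
        ∃ g, List.ofFn g = l ∧ ReachableConf (SimpleGraph.cycleGraph n) StarSwap f g := by
      intro l hl
      induction hl with
      | refl => exact ⟨f, rfl, .refl⟩
      | tail _ hstep ih =>
        obtain ⟨g, rfl, hg⟩ := ih
        obtain ⟨g', rfl, hg'⟩ := hstep.exists_swapStep hn
        exact ⟨g', rfl, hg.tail hg'⟩
    obtain ⟨g', hg', hr⟩ := key _ h
    rwa [List.ofFn_injective hg'] at hr

theorem List.count_ofFn_eq_ncard {α : Type*} [DecidableEq α] {n : ℕ} (f : Fin n → α) (a : α) :
    (List.ofFn f).count a = {v | f v = a}.ncard := by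
  rw [Set.ncard_eq_toFinset_card', Set.toFinset_ofPred, List.ofFn_eq_map, List.count,
    List.countP_map, List.countP_eq_length_filter]
  rfl

theorem CyclicListStep.perm {l l' : List ℕ} (h : CyclicListStep l l') : l.Perm l' := by
  cases h with
  | mid a b x y h => exact (List.Perm.swap y x b).append_left a
  | wrap m x y h =>
    exact (List.perm_append_singleton y m).cons x |>.trans <| (List.Perm.swap y x m).trans <|
      (List.perm_append_singleton x m).symm.cons y

/-- On a cycle with `n ≥ 3` vertices with the star swap graph centered at color `1`,
if `f` has at least one blank vertex, then `g` is reachable from `f` iff `L(g)` is a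
cyclic rotation of `L(f)` and `g` has the same number of blank vertices as `f`. -/
theorem cycle_reachability_characterization (n : ℕ) (hn : 3 ≤ n)
    (f g : Fin n → ℕ) (hblank : ∃ v : Fin n, f v = 1) :
    ReachableConf (SimpleGraph.cycleGraph n) StarSwap f g ↔
      (nonBlankList f ~r nonBlankList g ∧
        {v | g v = 1}.ncard = {v | f v = 1}.ncard) := by
  rw [reachableConf_cycleGraph_iff hn, ← List.count_ofFn_eq_ncard, ← List.count_ofFn_eq_ncard]
  constructor
  · intro h
    unfold nonBlankList
    generalize List.ofFn g = l at *
    induction h with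
    | refl => exact ⟨.refl _, rfl⟩
    | tail _ hstep ih =>
      exact ⟨ih.1.trans hstep.filter_isRotated, (hstep.perm.count_eq 1).symm.trans ih.2⟩
  · rintro ⟨hr, hc⟩
    exact CyclicListStep.reflTransGen_of_isRotated (by simpa [List.mem_ofFn] using hblank) hr hc.symm
end

section
/- Consider the edge-gadget graph H with vertex set {u, x1, x2, x3, x4, x5, x6, v} and edges {u,x1}, {x1,x2}, {x2,x3}, {x3,x4}, {x4,x5}, {x5,x6}, {x6,v}, {x2,x4}, with the path swap graph on colors {1,2,3,4}. Let f be the configuration f(u)=1, f(x1)=1, f(x2)=1, f(x3)=3, f(x4)=1, f(x5)=4, f(x6)=1, f(v)=2 (the gadget is oriented towards u and a token of color 2 enters from v's side). Then every configuration h reachable from f satisfies h(w) ≠ 2 for all vertices w ∉ {v, x6} (the token of color 2 remains confined to v and x6; in particular it can never reach u). -/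
/-- The path swap graph on colors `{1, 2, 3, 4}`: colors `c` and `d` may be swapped iff
`|c - d| = 1`. -/
def PathSwap (c d : ℕ) : Prop := c = d + 1 ∨ d = c + 1

/-- The edge-gadget graph on vertices `u = 0, x1 = 1, ..., x6 = 6, v = 7`, consisting of
the path `u x1 x2 x3 x4 x5 x6 v` together with the chord `{x2, x4}`. -/
def edgeGadget : SimpleGraph (Fin 8) :=
  SimpleGraph.fromEdgeSet
    {s(0, 1), s(1, 2), s(2, 3), s(3, 4), s(4, 5), s(5, 6), s(6, 7), s(2, 4)}

/-- Only two configurations are reachable: the `2` is at `v` or at `x6`, and no other swap is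
allowed from either of them. -/
theorem ReachableConf.edgeGadget_eq_or_eq {h : Fin 8 → ℕ}
    (hreach : ReachableConf edgeGadget PathSwap ![1, 1, 1, 3, 1, 4, 1, 2] h) :
    h = ![1, 1, 1, 3, 1, 4, 1, 2] ∨ h = ![1, 1, 1, 3, 1, 4, 2, 1] := by
  induction hreach with
  | refl => exact Or.inl rfl
  | tail _ hstep ih =>
    obtain ⟨u, v, hadj, hswap, rfl⟩ := hstep
    rcases ih with rfl | rfl <;> fin_cases u <;> fin_cases v <;>
      first
      | (simp [PathSwap] at hswap; done)
      | (simp [edgeGadget] at hadj; done)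
      | (left; decide)
      | (right; decide)

/-- In the edge gadget oriented towards `u`, a token of color `2` entering from `v`'s
side remains confined to `v` and `x6`: every reachable configuration has no token of
color `2` outside `{v, x6}`; in particular the token of color `2` can never reach
`u`. -/
theorem edge_gadget_color2_blocked (h : Fin 8 → ℕ)
    (hreach : ReachableConf edgeGadget PathSwap ![1, 1, 1, 3, 1, 4, 1, 2] h) :
    ∀ w : Fin 8, w ≠ 7 → w ≠ 6 → h w ≠ 2 := by
  intro w h7 h6
  rcases hreach.edgeGadget_eq_or_eq with rfl | rfl <;> fin_cases w <;> simp_all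
end
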